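/- arXiv:1708.03895 — 2 statements merged into one kernel-verified Lean document; each statement's English description precedes it below -/
import Mathlib

section
/- Full large deviation upper bound for the empirical locality measure of a conditioned typed random graph: Suppose the sequence (η_n, π_n) of (achievable empirical type measure, achievable empirical link measure) pairs converges pointwise to (η, π), where η is a probability measure on Z with η(a) > 0 for all a ∈ Z and π is a symmetric finite measure on Z × Z. Then for every closed subset Γ of the space of probability measures on Z × M(Z) (weak topology), limsup_{n→∞} (1/n) · log Q_{(η_n, π_n)}{ z : P_z ∈ Γ } ≤ − inf_{p ∈ Γ} J_{(η,π)}(p). -/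
open Filter
open scoped Classical
open scoped ENNReal BigOperators

/-- A typed (coloured) graph on `n` vertices: a type assignment together with a
simple graph on the vertex set `{1, …, n}`. -/
structure TypedGraph (n : ℕ) (Z : Type) where
  type : Fin n → Z
  graph : SimpleGraph (Fin n)

variable {Z : Type} [Fintype Z]

/-- The empirical type measure `P¹` of a typed graph:
`P¹(a) = (1/n) · #{i : z(i) = a}`. -/
noncomputable def typeMeasure {n : ℕ} (z : TypedGraph n Z) (a : Z) : ℝ :=
  (Nat.card {i : Fin n // z.type i = a} : ℝ) / n

/-- The empirical link measure `P²` of a typed graph: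
`P²(a,b) = (1/n) · #{oriented pairs (i,j) : {i,j} ∈ E, z(i) = a, z(j) = b}`. -/
noncomputable def linkMeasure {n : ℕ} (z : TypedGraph n Z) (a b : Z) : ℝ :=
  (Nat.card {ij : Fin n × Fin n //
      z.graph.Adj ij.1 ij.2 ∧ z.type ij.1 = a ∧ z.type ij.2 = b} : ℝ) / n

/-- The empirical locality measure `P_z` of a typed graph, a probability
measure on `Z × M(Z)` (where `M(Z) = Z →₀ ℕ` are counting measures on `Z`):
`P_z(a,e) = (1/n) · #{i : z(i) = a and i has exactly e(b) neighbours of type b, ∀ b}`. -/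
noncomputable def localityMeasure {n : ℕ} (z : TypedGraph n Z) :
    Z × (Z →₀ ℕ) → ℝ := fun x =>
  (Nat.card {i : Fin n // z.type i = x.1 ∧ ∀ b : Z,
      Nat.card {j : Fin n // z.graph.Adj i j ∧ z.type j = b} = x.2 b} : ℝ) / n

/-- `condProb n ηn πn A` is the probability of the event `A` under the uniform
distribution `Q_{(ηn, πn)}` on typed graphs on `n` vertices conditioned to have
empirical type measure `ηn` and empirical link measure `πn`. -/
noncomputable def condProb (n : ℕ) (ηn : Z → ℝ) (πn : Z → Z → ℝ)
    (A : Set (TypedGraph n Z)) : ℝ≥0∞ :=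
  (Nat.card {z : TypedGraph n Z //
      (typeMeasure z = ηn ∧ linkMeasure z = πn) ∧ z ∈ A} : ℝ≥0∞) /
  (Nat.card {z : TypedGraph n Z // typeMeasure z = ηn ∧ linkMeasure z = πn} : ℝ≥0∞)

/-- `p` is a probability mass function: nonnegative with total mass one. -/
def IsPMF {X : Type*} (p : X → ℝ) : Prop := (∀ x, 0 ≤ p x) ∧ HasSum p 1

/-- Relative entropy `H(p ∥ q) = Σ_x p(x) log (p(x)/q(x)) ∈ [0,∞]` of probability
mass functions.  Since each term `p log (p/q) - p + q` is nonnegative and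
`Σ (p - q) = 0`, this agrees with the usual definition; if `p` is not absolutely
continuous with respect to `q`, the relative entropy is `∞`. -/
noncomputable def relEntropy {X : Type*} (p q : X → ℝ) : ℝ≥0∞ :=
  if ∀ x, q x = 0 → p x = 0 then
    ∑' x, ENNReal.ofReal (p x * Real.log (p x / q x) - p x + q x)
  else ∞

/-- The reference measure `q` on `Z × M(Z)`:
`q(a,e) = η(a) ∏_b e^{-π(a,b)/η(a)} (π(a,b)/η(a))^{e(b)} / e(b)!`. -/
noncomputable def qMeasure (η : Z → ℝ) (π : Z → Z → ℝ) : Z × (Z →₀ ℕ) → ℝ :=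
  fun x => η x.1 * ∏ b : Z,
    Real.exp (-(π x.1 b) / η x.1) * (π x.1 b / η x.1) ^ (x.2 b) / ((x.2 b).factorial : ℝ)

/-- The pair `(π, p)` is sub-consistent: `Σ_e p(a,e) e(b) ≤ π(a,b)` for all `a, b`
(the sum taken in `[0,∞]`). -/
def SubConsistent (π : Z → Z → ℝ) (p : Z × (Z →₀ ℕ) → ℝ) : Prop :=
  ∀ a b : Z, ∑' e : Z →₀ ℕ, ENNReal.ofReal (p (a, e) * (e b : ℝ)) ≤ ENNReal.ofReal (π a b)

/-- The rate function `J_{(η,π)}(p) = H(p ∥ q)` if `p` is a probability measure,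
`(π, p)` is sub-consistent and the `Z`-marginal of `p` is `η`; and `∞` otherwise. -/
noncomputable def rateJ (η : Z → ℝ) (π : Z → Z → ℝ) (p : Z × (Z →₀ ℕ) → ℝ) : ℝ≥0∞ :=
  if IsPMF p ∧ SubConsistent π p ∧ (∀ a : Z, HasSum (fun e : Z →₀ ℕ => p (a, e)) (η a)) then
    relEntropy p (qMeasure η π)
  else ∞


set_option linter.unusedVariables false
set_option linter.unusedSectionVars false
set_option linter.unusedSimpArgs false

section core
variable {V : Type} [Fintype V]

noncomputable def dg (t : V → Z) (G : SimpleGraph V) (x : V × Z) : ℕ :=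
  ∑ w, if G.Adj x.1 w ∧ t w = x.2 then 1 else 0

noncomputable def lk (t : V → Z) (G : SimpleGraph V) (p : Z × Z) : ℕ :=
  ∑ i, if t i = p.1 then dg t G (i, p.2) else 0

noncomputable def cls (t : V → Z) (a : Z) : Finset V := Finset.univ.filter (fun i => t i = a)

/-- `G` is `G'` plus a new edge `ij`. -/
def IsAdd (G' G : SimpleGraph V) (i j : V) : Prop :=
  i ≠ j ∧ ¬ G'.Adj i j ∧ ∀ u v, G.Adj u v ↔ G'.Adj u v ∨ (u = i ∧ v = j) ∨ (u = j ∧ v = i)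

lemma dg_add (t : V → Z) {G' G : SimpleGraph V} {i j : V} (h : IsAdd G' G i j) :
    dg t G = dg t G' + Pi.single (i, t j) 1 + Pi.single (j, t i) 1 := by
  obtain ⟨hij, hn, hadj⟩ := h
  have hn' : ¬ G'.Adj j i := fun h => hn h.symm
  funext ⟨v, c⟩
  have key : ∀ w, (if G.Adj v w ∧ t w = c then 1 else 0) =
      (if G'.Adj v w ∧ t w = c then 1 else 0) + (if w = j then (if v = i ∧ t j = c then 1 else 0) else 0)
       + (if w = i then (if v = j ∧ t i = c then 1 else 0) else 0 : ℕ) := by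
    intro w
    rw [hadj]
    by_cases h1 : w = j
    · subst h1
      by_cases h2 : v = i
      · subst h2; simp [hn, hij, hij.symm]
      · simp [h2, hij.symm]
    · by_cases h1' : w = i
      · subst h1'
        by_cases h2 : v = j
        · subst h2; simp [hn', hij]
        · simp [h2, hij]
      · simp [h1, h1']
  simp only [dg, Pi.add_apply]
  rw [Finset.sum_congr rfl (fun w _ => key w)]
  rw [Finset.sum_add_distrib, Finset.sum_add_distrib]
  simp only [Finset.sum_ite_eq', Finset.mem_univ, if_true, Pi.single_apply, Prod.mk.injEq]
  rw [@eq_comm _ (t j) c, @eq_comm _ (t i) c]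

lemma lk_add (t : V → Z) {G' G : SimpleGraph V} {i j : V} (h : IsAdd G' G i j) :
    lk t G = lk t G' + Pi.single (t i, t j) 1 + Pi.single (t j, t i) 1 := by
  funext ⟨a, b⟩
  simp only [lk, Pi.add_apply, dg_add t h, Pi.single_apply, Prod.mk.injEq]
  have key : ∀ k, (if t k = a then dg t G' (k, b) + (if k = i ∧ b = t j then 1 else 0) +
      (if k = j ∧ b = t i then 1 else 0) else 0) =
      (if t k = a then dg t G' (k, b) else 0) + (if k = i then (if a = t i ∧ b = t j then 1 else 0) else 0)
       + (if k = j then (if a = t j ∧ b = t i then 1 else 0) else 0) := by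
    intro k
    by_cases h1 : k = i
    · subst h1
      by_cases h3 : k = j
      · subst h3
        by_cases h2 : t k = a
        · simp [h2]
        · simp [h2, Ne.symm h2]
      · by_cases h2 : t k = a
        · simp [h2, h3]
        · simp [h2, Ne.symm h2, h3]
    · by_cases h3 : k = j
      · subst h3
        by_cases h2 : t k = a
        · simp [h2, h1]
        · simp [h2, Ne.symm h2, h1]
      · simp [h1, h3]
  rw [Finset.sum_congr rfl (fun w _ => key w)]
  rw [Finset.sum_add_distrib, Finset.sum_add_distrib]
  simp only [Finset.sum_ite_eq', Finset.mem_univ, if_true]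

lemma isAdd_sup {G' : SimpleGraph V} {i j : V} (hij : i ≠ j) (hn : ¬ G'.Adj i j) :
    IsAdd G' (G' ⊔ SimpleGraph.edge i j) i j := by
  refine ⟨hij, hn, fun u v => ?_⟩
  simp only [SimpleGraph.sup_adj, SimpleGraph.edge_adj]
  constructor
  · rintro (h | ⟨h | h, _⟩) <;> tauto
  · rintro (h | ⟨rfl, rfl⟩ | ⟨rfl, rfl⟩)
    · tauto
    · right; exact ⟨Or.inl ⟨rfl, rfl⟩, hij⟩
    · right; exact ⟨Or.inr ⟨rfl, rfl⟩, hij.symm⟩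

lemma isAdd_sdiff {G : SimpleGraph V} {i j : V} (hn : G.Adj i j) :
    IsAdd (G \ SimpleGraph.edge i j) G i j := by
  refine ⟨hn.ne, ?_, fun u v => ?_⟩
  · simp [SimpleGraph.sdiff_adj, SimpleGraph.edge_adj, hn.ne]
  simp only [SimpleGraph.sdiff_adj, SimpleGraph.edge_adj]
  constructor
  · intro h
    have := h.ne
    tauto
  · rintro (h | ⟨rfl, rfl⟩ | ⟨rfl, rfl⟩)
    · exact h.1
    · exact hn
    · exact hn.symm

lemma isAdd_right_unique {G' G₁ G₂ : SimpleGraph V} {i j : V} (h1 : IsAdd G' G₁ i j)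
    (h2 : IsAdd G' G₂ i j) : G₁ = G₂ := by
  ext u v; rw [h1.2.2, h2.2.2]

lemma isAdd_left_unique {G G₁ G₂ : SimpleGraph V} {i j : V} (h1 : IsAdd G₁ G i j)
    (h2 : IsAdd G₂ G i j) : G₁ = G₂ := by
  ext u v
  have e1 := h1.2.2 u v
  have e2 := h2.2.2 u v
  by_cases ha : (u = i ∧ v = j)
  · obtain ⟨rfl, rfl⟩ := ha
    simp [h1.2.1, h2.2.1]
  by_cases hb : (u = j ∧ v = i)
  · obtain ⟨rfl, rfl⟩ := hb
    have := fun h : G₁.Adj u v => h1.2.1 h.symm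
    have := fun h : G₂.Adj u v => h2.2.1 h.symm
    tauto
  tauto

lemma lk_eq_card (t : V → Z) (G : SimpleGraph V) (a b : Z) :
    lk t G (a, b) = ((cls t a ×ˢ cls t b).filter (fun p => G.Adj p.1 p.2)).card := by
  rw [Finset.card_filter, Finset.sum_product, lk, ← Finset.sum_filter]
  refine Finset.sum_congr rfl fun i _ => ?_
  simp only [dg, cls, Finset.sum_filter]
  refine Finset.sum_congr rfl fun j _ => ?_
  by_cases h : t j = b <;> simp [h]

noncomputable def gD (t : V → Z) (D : V × Z → ℕ) : Finset (SimpleGraph V) :=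
  Finset.univ.filter (fun G => dg t G = D)
noncomputable def gL (t : V → Z) (m : Z × Z → ℕ) : Finset (SimpleGraph V) :=
  Finset.univ.filter (fun G => lk t G = m)

lemma lower_step (t : V → Z) (m : Z × Z → ℕ) (a b : Z) (m' : Z × Z → ℕ)
    (hm : m = m' + Pi.single (a, b) 1 + Pi.single (b, a) 1) :
    ((cls t a).card * (cls t b).card : ℤ) * (gL t m').card
     - ((cls t a).card + m' (a,b)) * (gL t m').card ≤ m (a, b) * (gL t m).card := by
  -- pairs
  set P := cls t a ×ˢ cls t b with hP
  have h1 : m (a,b) * (gL t m).card = ((gL t m ×ˢ P).filter (fun x => x.1.Adj x.2.1 x.2.2)).card := by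
    rw [Finset.card_filter, Finset.sum_product]
    rw [Finset.sum_congr rfl (g := fun _ => m (a,b))]
    · simp [mul_comm]
    · intro G hG
      rw [← Finset.card_filter, hP, ← lk_eq_card]
      simp only [gL, Finset.mem_filter] at hG
      rw [hG.2]
  have h2 : ((gL t m' ×ˢ P).filter (fun x => x.2.1 ≠ x.2.2 ∧ ¬ x.1.Adj x.2.1 x.2.2)).card ≤
      ((gL t m ×ˢ P).filter (fun x => x.1.Adj x.2.1 x.2.2)).card := by
    refine Finset.card_le_card_of_injOn
      (fun x => (x.1 ⊔ SimpleGraph.edge x.2.1 x.2.2, x.2)) ?_ ?_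
    · rintro ⟨G, i, j⟩ hx
      simp only [Finset.coe_filter, Finset.mem_product, Set.mem_ofPred_eq, gL, Finset.mem_filter,
        Finset.mem_univ, true_and, hP, cls] at hx ⊢
      obtain ⟨⟨hG, hi, hj⟩, hij, hn⟩ := hx
      have := isAdd_sup hij hn
      refine ⟨⟨?_, hi, hj⟩, ?_⟩
      · rw [lk_add t this, hG, hm, hi, hj]
      · rw [this.2.2]; tauto
    · rintro ⟨G, i, j⟩ hx ⟨G2, i2, j2⟩ hx2 heq
      simp only [Prod.mk.injEq] at heq
      obtain ⟨h1, rfl, rfl⟩ := heq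
      simp only [Finset.coe_filter, Set.mem_ofPred_eq] at hx hx2
      have e1 := isAdd_sup hx.2.1 hx.2.2
      have e2 := isAdd_sup hx2.2.1 hx2.2.2
      rw [← h1] at e2
      rw [isAdd_left_unique e1 e2]
  have h3 : ((cls t a).card * (cls t b).card : ℤ) * (gL t m').card
     - ((cls t a).card + m' (a,b)) * (gL t m').card ≤
      ((gL t m' ×ˢ P).filter (fun x => x.2.1 ≠ x.2.2 ∧ ¬ x.1.Adj x.2.1 x.2.2)).card := by
    rw [Finset.card_filter, Finset.sum_product]
    have : ∀ G ∈ gL t m', ((cls t a).card * (cls t b).card : ℤ) - ((cls t a).card + m' (a,b))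
       ≤ ((∑ x ∈ P, if x.1 ≠ x.2 ∧ ¬ G.Adj x.1 x.2 then 1 else 0 : ℕ) : ℤ) := by
      intro G hG
      simp only [gL, Finset.mem_filter, Finset.mem_univ, true_and] at hG
      rw [← Finset.card_filter]
      have e1 : P.card ≤ (P.filter (fun x => x.1 ≠ x.2 ∧ ¬ G.Adj x.1 x.2)).card +
        ((P.filter (fun x => x.1 = x.2)).card + (P.filter (fun x => G.Adj x.1 x.2)).card) := by
        refine le_trans (Finset.card_le_card ?_) ((Finset.card_union_le _ _).trans
          (Nat.add_le_add_left (Finset.card_union_le _ _) _))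
        intro x hx
        simp only [Finset.mem_union, Finset.mem_filter]
        tauto
      have e2 : (P.filter (fun x => x.1 = x.2)).card ≤ (cls t a).card := by
        refine Finset.card_le_card_of_injOn (fun x => x.1) ?_ ?_
        · intro x hx
          simp only [hP, Finset.coe_filter, Finset.mem_product, Set.mem_ofPred_eq] at hx
          exact hx.1.1
        · rintro ⟨x, y⟩ hx ⟨x2, y2⟩ hx2 h
          simp only [Finset.coe_filter, Set.mem_ofPred_eq] at hx hx2 h
          rw [Prod.mk.injEq]
          exact ⟨h, by rw [← hx.2, ← hx2.2, h]⟩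
      have e3 : (P.filter (fun x => G.Adj x.1 x.2)).card = m' (a,b) := by
        rw [← hG, lk_eq_card]
      have e4 : P.card = (cls t a).card * (cls t b).card := Finset.card_product _ _
      push_cast [← @Nat.cast_inj ℤ] at e4
      zify at e1 e2 e3
      linarith
    have := Finset.sum_le_sum this
    rw [Finset.sum_const, nsmul_eq_mul] at this
    push_cast at this ⊢
    linarith
  rw [← h1] at h2
  refine h3.trans ?_
  exact_mod_cast h2

lemma upper_step (t : V → Z) (D : V × Z → ℕ) (m : Z × Z → ℕ)
    (hDm : ∀ G ∈ gD t D, lk t G = m) (a b : Z) :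
    m (a, b) * (gD t D).card = ∑ p ∈ cls t a ×ˢ cls t b,
      ((gD t D).filter (fun G => G.Adj p.1 p.2)).card := by
  simp_rw [Finset.card_filter]
  rw [Finset.sum_comm, Finset.sum_congr rfl (g := fun _ => m (a,b))]
  · simp [mul_comm]
  · intro G hG
    rw [← Finset.card_filter, ← lk_eq_card, hDm G hG]

lemma upper_step2 (t : V → Z) (D : V × Z → ℕ) {G₁ : SimpleGraph V} {i j : V}
    (h1 : dg t G₁ = D) (hadj : G₁.Adj i j) :
    ((gD t D).filter (fun G => G.Adj i j)).card ≤
      (gD t (dg t (G₁ \ SimpleGraph.edge i j))).card := by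
  refine Finset.card_le_card_of_injOn (fun G => G \ SimpleGraph.edge i j) ?_ ?_
  · intro G hG
    simp only [gD, Finset.coe_filter, Finset.mem_filter, Finset.mem_univ, true_and,
      Set.mem_ofPred_eq] at hG ⊢
    have e1 := dg_add t (isAdd_sdiff hG.2)
    have e2 := dg_add t (isAdd_sdiff hadj)
    rw [hG.1, ← h1, e2] at e1
    simpa using e1.symm
  · intro G hG G2 hG2 h
    simp only [Finset.coe_filter, Set.mem_ofPred_eq] at hG hG2 h
    have e1 := isAdd_sdiff hG.2
    have e2 := isAdd_sdiff hG2.2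
    rw [← h] at e2
    exact isAdd_right_unique e1 e2

end core

section core2
variable {V : Type} [Fintype V]

noncomputable def FF {ι : Type} [Fintype ι] (c : ι → ℝ) (f : ι → ℕ) : ℝ :=
  ∏ y, (((f y).factorial : ℝ) * c y ^ (f y))

lemma FF_single {ι : Type} [Fintype ι] [DecidableEq ι] (c : ι → ℝ) (f : ι → ℕ) (x : ι) :
    FF c (f + Pi.single x 1) = FF c f * ((f x + 1) * c x) := by
  unfold FF
  rw [← Finset.mul_prod_erase _ _ (Finset.mem_univ x),
    ← Finset.mul_prod_erase (Finset.univ) (fun y => ((f y).factorial : ℝ) * c y ^ (f y)) (Finset.mem_univ x)]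
  have : ∏ y ∈ Finset.univ.erase x, ((((f + Pi.single x 1 : ι → ℕ) y).factorial : ℝ) * c y ^ ((f + Pi.single x 1 : ι → ℕ) y))
     = ∏ y ∈ Finset.univ.erase x, (((f y).factorial : ℝ) * c y ^ (f y)) := by
    refine Finset.prod_congr rfl fun y hy => ?_
    have : y ≠ x := (Finset.mem_erase.1 hy).1
    simp [this]
  rw [this]
  simp only [Pi.add_apply, Pi.single_eq_same, Nat.factorial_succ, pow_succ]
  push_cast
  ring

lemma FF_one_pos {ι : Type} [Fintype ι] (f : ι → ℕ) : 0 < FF (fun _ => 1) f := by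
  unfold FF
  refine Finset.prod_pos fun y _ => ?_
  have := Nat.factorial_pos (f y)
  simp [this]

lemma FF_nonneg {ι : Type} [Fintype ι] (c : ι → ℝ) (hc : ∀ i, 0 ≤ c i) (f : ι → ℕ) : 0 ≤ FF c f := by
  unfold FF
  refine Finset.prod_nonneg fun y _ => ?_
  have := hc y
  positivity

lemma lk_of_dg (t : V → Z) {G G' : SimpleGraph V} (h : dg t G = dg t G') : lk t G = lk t G' := by
  unfold lk; rw [h]

lemma lk_eq_sum (t : V → Z) (G : SimpleGraph V) (a b : Z) :
    lk t G (a, b) = ∑ i ∈ cls t a, dg t G (i, b) := by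
  simp [lk, cls, Finset.sum_filter]

lemma W_bound (t : V → Z) (G : SimpleGraph V) (m' : Z × Z → ℕ) (a b : Z)
    (hm : lk t G = m' + Pi.single (a, b) 1 + Pi.single (b, a) 1) :
    ∑ p ∈ cls t a ×ˢ cls t b, (if p.1 ≠ p.2 then dg t G (p.1, b) * dg t G (p.2, a) else 0) ≤
      (m' (a, b) + 1) * lk t G (b, a) := by
  rw [Finset.sum_product_right, lk_eq_sum, Finset.mul_sum]
  refine Finset.sum_le_sum fun j hj => ?_
  have hab : lk t G (a, b) = m' (a, b) + 1 + (if a = b then 1 else 0) := by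
    rw [hm]
    by_cases h : a = b
    · subst h; simp
    · simp [h, Pi.single_apply]
  have h1 : ∑ i ∈ cls t a, (if i ≠ j then dg t G (i, b) * dg t G (j, a) else 0)
     = (∑ i ∈ cls t a, (if i ≠ j then dg t G (i, b) else 0)) * dg t G (j, a) := by
    rw [Finset.sum_mul]
    refine Finset.sum_congr rfl fun i _ => ?_
    split_ifs <;> simp
  simp only at h1 ⊢
  rw [h1]
  rcases Nat.eq_zero_or_pos (dg t G (j, a)) with h0 | h0
  · simp [h0]
  refine Nat.mul_le_mul_right _ ?_
  by_cases h : a = b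
  · subst h
    have e : ∑ i ∈ cls t a, dg t G (i, a) = (∑ i ∈ cls t a, (if i ≠ j then dg t G (i, a) else 0))
       + dg t G (j, a) := by
      have : ∀ i ∈ cls t a, dg t G (i, a) = (if i ≠ j then dg t G (i, a) else 0) +
          (if i = j then dg t G (j, a) else 0) := by
        intro i _
        by_cases hij : i = j <;> simp [hij]
      rw [Finset.sum_congr rfl this, Finset.sum_add_distrib]
      simp [hj]
    rw [← lk_eq_sum] at e
    simp at hab
    omega
  · simp only [h, if_false, add_zero] at hab
    rw [← hab, lk_eq_sum]
    refine Finset.sum_le_sum fun i _ => ?_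
    split_ifs <;> simp

lemma core_bound (t : V → Z) (ε : ℝ) (hε : 0 ≤ ε) (hε1 : ε < 1) (hN : ∀ a, 0 < (cls t a).card) :
    ∀ (S : ℕ) (G₀ : SimpleGraph V), ∑ p, lk t G₀ p = S →
    (∀ a b, ((cls t a).card : ℝ) + lk t G₀ (a, b) ≤ ε * ((cls t a).card * (cls t b).card)) →
    ((gD t (dg t G₀)).card : ℝ) ≤ (gL t (lk t G₀)).card * ((1 - ε)⁻¹) ^ S *
      FF (fun p : Z × Z => 1 / ((cls t p.1).card : ℝ)) (lk t G₀) * (FF (fun _ => 1) (dg t G₀))⁻¹ := by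
  intro S
  have hB : 1 ≤ (1 - ε)⁻¹ := by
    rw [one_le_inv₀ (by linarith)]; linarith
  have hB0 : 0 < 1 - ε := by linarith
  induction S using Nat.strong_induction_on with
  | _ S ih =>
  intro G₀ hS hcond
  have hmono : (gD t (dg t G₀)).card ≤ (gL t (lk t G₀)).card := by
    refine Finset.card_le_card fun G hG => ?_
    simp only [gD, gL, Finset.mem_filter, Finset.mem_univ, true_and] at hG ⊢
    exact lk_of_dg t hG
  rcases Nat.eq_zero_or_pos S with h0 | hpos
  · subst h0
    have hz : ∀ p, lk t G₀ p = 0 := by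
      intro p
      have := Finset.sum_eq_zero_iff.1 hS p (Finset.mem_univ _)
      exact this
    have hd : ∀ x, dg t G₀ x = 0 := by
      rintro ⟨i, b⟩
      have h := hz (t i, b)
      rw [lk_eq_sum] at h
      exact Finset.sum_eq_zero_iff.1 h i (by simp [cls])
    simp only [FF, hz, hd]
    simpa using hmono
  obtain ⟨⟨a, b⟩, hab⟩ : ∃ p, 0 < lk t G₀ p := by
    by_contra hcon
    push Not at hcon
    have : ∑ p, lk t G₀ p = 0 := Finset.sum_eq_zero fun p _ => Nat.le_zero.1 (hcon p)
    omega
  have hab' := hab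
  rw [lk_eq_card, Finset.card_pos] at hab'
  obtain ⟨⟨i₀, j₀⟩, hij₀⟩ := hab'
  simp only [Finset.mem_filter, Finset.mem_product, cls, Finset.mem_univ, true_and] at hij₀
  obtain ⟨⟨hi₀, hj₀⟩, hadj₀⟩ := hij₀
  set m' := lk t (G₀ \ SimpleGraph.edge i₀ j₀) with hm'
  have hm : lk t G₀ = m' + Pi.single (a, b) 1 + Pi.single (b, a) 1 := by
    rw [lk_add t (isAdd_sdiff hadj₀), hi₀, hj₀]
  set D := dg t G₀ with hD
  have hm'le : ∀ p, m' p ≤ lk t G₀ p := by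
    intro p; rw [hm]; simp only [Pi.add_apply]; omega
  have hS' : ∑ p, m' p + 2 = S := by
    rw [← hS, hm]
    simp [Finset.sum_add_distrib]
  set Na : ℝ := ((cls t a).card : ℝ)
  set Nb : ℝ := ((cls t b).card : ℝ)
  have hNa : 0 < Na := Nat.cast_pos.2 (hN a)
  have hNb : 0 < Nb := Nat.cast_pos.2 (hN b)
  set Fm' := FF (fun p : Z × Z => 1 / ((cls t p.1).card : ℝ)) m' with hFm'
  have hFm'0 : 0 ≤ Fm' := FF_nonneg _ (fun i => by positivity) _
  have hFD := FF_one_pos D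
  set X : ℝ := (gL t m').card * ((1 - ε)⁻¹) ^ (S - 2) * Fm' * (FF (fun _ => 1) D)⁻¹ with hX
  have hX0 : 0 ≤ X := by positivity
  have hterm : ∀ p ∈ cls t a ×ˢ cls t b, (((gD t D).filter (fun G => G.Adj p.1 p.2)).card : ℝ) ≤
      X * ((if p.1 ≠ p.2 then D (p.1, b) * D (p.2, a) else 0 : ℕ) : ℝ) := by
    rintro ⟨i, j⟩ hp
    simp only [Finset.mem_product, cls, Finset.mem_filter, Finset.mem_univ, true_and] at hp
    obtain ⟨hi, hj⟩ := hp
    rcases Finset.eq_empty_or_nonempty ((gD t D).filter (fun G => G.Adj i j)) with he | ⟨G, hG⟩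
    · rw [he]; simp only [Finset.card_empty, Nat.cast_zero]; positivity
    simp only [gD, Finset.mem_filter, Finset.mem_univ, true_and] at hG
    obtain ⟨hGD, hadj⟩ := hG
    have hu := upper_step2 t D hGD hadj
    have hlk : lk t G = lk t G₀ := lk_of_dg t hGD
    have hadd := isAdd_sdiff hadj
    have hmG : lk t (G \ SimpleGraph.edge i j) = m' := by
      have e := lk_add t hadd
      rw [hlk, hm, hi, hj] at e
      simpa using e.symm
    have hDG := dg_add t hadd
    rw [hGD, hi, hj] at hDG
    set D' := dg t (G \ SimpleGraph.edge i j) with hD'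
    have hne : i ≠ j := hadj.ne
    have hIH := ih (S - 2) (by omega) (G \ SimpleGraph.edge i j) (by rw [hmG]; omega) (by
      intro c d
      rw [hmG]
      have := hcond c d
      have h2 : (m' (c, d) : ℝ) ≤ lk t G₀ (c, d) := by exact_mod_cast hm'le _
      linarith)
    rw [hmG] at hIH
    have hFF : FF (fun _ => (1:ℝ)) D = FF (fun _ => 1) D' * ((D (i, b) * D (j, a) : ℕ) : ℝ) := by
      rw [hDG, FF_single, FF_single]
      simp only [Pi.add_apply, Pi.single_apply, Prod.mk.injEq, hne, hne.symm, false_and, if_false,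
        true_and, if_true]
      push_cast
      ring
    have hpos1 := FF_one_pos D'
    rw [← hFm', ← hD'] at hIH
    have hinv : (FF (fun _ => (1:ℝ)) D')⁻¹ = (FF (fun _ => 1) D)⁻¹ * ((D (i, b) * D (j, a) : ℕ) : ℝ) := by
      have hw : ((D (i, b) * D (j, a) : ℕ) : ℝ) ≠ 0 := by
        intro h0
        rw [h0, mul_zero] at hFF
        linarith
      rw [hFF]
      field_simp
    rw [hinv] at hIH
    simp only [ne_eq, hne, not_false_eq_true, if_true]
    calc _ ≤ ((gD t D').card : ℝ) := by exact_mod_cast hu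
      _ ≤ _ := hIH
      _ = _ := by rw [hX]; ring
  have hup := upper_step t D (lk t G₀) (fun G hG => by
    simp only [gD, Finset.mem_filter, Finset.mem_univ, true_and] at hG
    exact lk_of_dg t hG) a b
  have hW := W_bound t G₀ m' a b hm
  have h1 : (lk t G₀ (a, b) : ℝ) * (gD t D).card ≤ X * ((m' (a, b) + 1) * lk t G₀ (b, a)) := by
    have : ((lk t G₀ (a, b) * (gD t D).card : ℕ) : ℝ) ≤ X * (((m' (a, b) + 1) * lk t G₀ (b, a) : ℕ) : ℝ) := by
      rw [hup]
      push_cast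
      refine (Finset.sum_le_sum hterm).trans ?_
      rw [← Finset.mul_sum]
      refine mul_le_mul_of_nonneg_left ?_ hX0
      exact_mod_cast hW
    exact_mod_cast this
  have hFm : FF (fun p : Z × Z => 1 / ((cls t p.1).card : ℝ)) (lk t G₀) * (Na * Nb) =
      Fm' * ((m' (a, b) + 1) * lk t G₀ (b, a)) := by
    have hba : (lk t G₀ (b, a) : ℝ) = ((m' + Pi.single (a, b) 1 : Z × Z → ℕ) (b, a) : ℕ) + 1 := by
      rw [hm]; simp
    rw [hba]
    rw [hm, FF_single, FF_single, ← hFm']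
    change Fm' * (_ * (1 / Na)) * (_ * (1 / Nb)) * (Na * Nb) = _
    field_simp
  have hlow := lower_step t (lk t G₀) a b m' hm
  have hlow' : (1 - ε) * (Na * Nb) * (gL t m').card ≤ lk t G₀ (a, b) * (gL t (lk t G₀)).card := by
    have h : (Na * Nb) * (gL t m').card - (Na + m' (a,b)) * (gL t m').card ≤
      lk t G₀ (a, b) * (gL t (lk t G₀)).card := by
      have := (Int.cast_le (R := ℝ)).2 hlow
      push_cast at this
      exact this
    have h2 := hcond a b
    have h3 : (m' (a, b) : ℝ) ≤ lk t G₀ (a, b) := by exact_mod_cast hm'le _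
    have h4 : (Na + m' (a,b)) * (gL t m').card ≤ (ε * (Na * Nb)) * (gL t m').card :=
      mul_le_mul_of_nonneg_right (by linarith) (by positivity)
    linarith
  set FM := FF (fun p : Z × Z => 1 / ((cls t p.1).card : ℝ)) (lk t G₀) with hFM
  have hFM0 : 0 ≤ FM := FF_nonneg _ (fun i => by positivity) _
  have hl : (0:ℝ) < lk t G₀ (a, b) := by exact_mod_cast hab
  refine le_of_mul_le_mul_left ?_ hl
  refine h1.trans ?_
  have hSS : ((1 - ε)⁻¹) ^ S = ((1 - ε)⁻¹) ^ (S - 2) * ((1 - ε)⁻¹) * ((1 - ε)⁻¹) := by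
    rw [← pow_succ, ← pow_succ]; congr 1; omega
  have hC : 0 ≤ ((1 - ε)⁻¹) ^ (S - 2) * FM * (FF (fun _ => 1) D)⁻¹ * (1 - ε)⁻¹ := by positivity
  calc X * ((m' (a, b) + 1) * lk t G₀ (b, a)) = (gL t m').card * ((1 - ε)⁻¹) ^ (S - 2) * (FF (fun _ => 1) D)⁻¹ *
        (Fm' * ((m' (a, b) + 1) * lk t G₀ (b, a))) := by rw [hX]; ring
    _ = ((1 - ε) * (Na * Nb) * (gL t m').card) * (((1 - ε)⁻¹) ^ (S - 2) * FM * (FF (fun _ => 1) D)⁻¹ * (1 - ε)⁻¹) := by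
        rw [← hFm]; field_simp
    _ ≤ (lk t G₀ (a, b) * (gL t (lk t G₀)).card) * (((1 - ε)⁻¹) ^ (S - 2) * FM * (FF (fun _ => 1) D)⁻¹ * (1 - ε)⁻¹) :=
        mul_le_mul_of_nonneg_right hlow' hC
    _ ≤ (lk t G₀ (a, b) * (gL t (lk t G₀)).card) * (((1 - ε)⁻¹) ^ (S - 2) * FM * (FF (fun _ => 1) D)⁻¹ * (1 - ε)⁻¹) * (1 - ε)⁻¹ :=
        le_mul_of_one_le_right (by positivity) hB
    _ = _ := by rw [hSS]; ring

end core2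

section poisson
variable {V : Type} [Fintype V]

lemma fact_bound (m : ℕ) : (m.factorial : ℝ) ≤ Real.exp 1 * (m + 1) * (Real.exp (-m) * (m : ℝ) ^ m) := by
  have key : ∀ k : ℕ, ((k+1).factorial : ℝ) * Real.exp ((k+1 : ℕ):ℝ) ≤ Real.exp 1 * (k + 1) * ((k:ℝ)+1) ^ (k+1) := by
    intro k
    induction k with
    | zero => simp
    | succ k ih =>
      have hlog : 1 - (((k:ℝ)+2)/(k+1))⁻¹ ≤ Real.log (((k:ℝ)+2)/(k+1)) :=
        Real.one_sub_inv_le_log_of_pos (by positivity)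
      have h1 : 1 ≤ ((k:ℝ)+2) * Real.log (((k:ℝ)+2)/(k+1)) := by
        have : 1 - (((k:ℝ)+2)/(k+1))⁻¹ = 1 / (k+2) := by
          rw [inv_div]; field_simp; ring
        rw [this, div_le_iff₀ (by positivity)] at hlog
        linarith
      have h2 : Real.exp 1 ≤ (((k:ℝ)+2)/(k+1)) ^ (k+2) := by
        have : (((k:ℝ)+2)/(k+1)) ^ (k+2) = Real.exp (((k:ℝ)+2) * Real.log (((k:ℝ)+2)/(k+1))) := by
          rw [mul_comm, Real.exp_mul, Real.exp_log (by positivity)]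
          norm_cast
        rw [this]
        exact Real.exp_le_exp.2 h1
      have h3 : Real.exp 1 * ((k:ℝ)+1)^(k+2) ≤ ((k:ℝ)+2)^(k+2) := by
        rw [div_pow, le_div_iff₀ (by positivity)] at h2
        exact h2
      have e1 : Real.exp ((k+1+1 : ℕ):ℝ) = Real.exp ((k+1 : ℕ) : ℝ) * Real.exp 1 := by
        rw [← Real.exp_add]; push_cast; ring_nf
      rw [Nat.factorial_succ, e1]
      push_cast
      push_cast at ih
      calc ((k:ℝ)+1+1) * (k+1).factorial * (Real.exp (k+1) * Real.exp 1)
          = ((k:ℝ)+2) * Real.exp 1 * ((k+1).factorial * Real.exp (k+1)) := by ring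
        _ ≤ ((k:ℝ)+2) * Real.exp 1 * (Real.exp 1 * (k + 1) * ((k:ℝ)+1) ^ (k+1)) :=
            mul_le_mul_of_nonneg_left ih (by positivity)
        _ = ((k:ℝ)+2) * Real.exp 1 * (Real.exp 1 * ((k:ℝ)+1) ^ (k+2)) := by ring
        _ ≤ ((k:ℝ)+2) * Real.exp 1 * ((k:ℝ)+2)^(k+2) :=
            mul_le_mul_of_nonneg_left h3 (by positivity)
        _ = _ := by
            have : (k:ℝ)+1+1 = k+2 := by ring
            rw [this]; ring
  rcases m with _ | k
  · simp
  have := key k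
  rw [Real.exp_neg]
  have hp : 0 < Real.exp ((k+1 : ℕ):ℝ) := Real.exp_pos _
  rw [show Real.exp 1 * (((k+1 : ℕ):ℝ) + 1) * ((Real.exp ((k+1 : ℕ):ℝ))⁻¹ * ((k+1 : ℕ):ℝ) ^ (k+1))
    = (Real.exp 1 * (((k+1 : ℕ):ℝ) + 1) * ((k+1 : ℕ):ℝ) ^ (k+1)) / Real.exp ((k+1 : ℕ):ℝ) by field_simp]
  rw [le_div_iff₀ hp]
  refine this.trans ?_
  push_cast
  gcongr
  linarith

noncomputable def poi (l : ℝ) (k : ℕ) : ℝ := Real.exp (-l) * l ^ k / (k.factorial : ℝ)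

lemma poi_nonneg {l : ℝ} (hl : 0 ≤ l) (k : ℕ) : 0 ≤ poi l k := by unfold poi; positivity

/-- product Poisson -/
noncomputable def PP (t : V → Z) (m : Z × Z → ℕ) (x : Z × (Z →₀ ℕ)) : ℝ :=
  ∏ b, poi ((m (x.1, b) : ℝ) / (cls t x.1).card) (x.2 b)

lemma PP_nonneg (t : V → Z) (m : Z × Z → ℕ) (x : Z × (Z →₀ ℕ)) : 0 ≤ PP t m x :=
  Finset.prod_nonneg fun b _ => poi_nonneg (by positivity) _

noncomputable def vd (t : V → Z) (G : SimpleGraph V) (i : V) : Z →₀ ℕ :=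
  Finsupp.equivFunOnFinite.symm (fun b => dg t G (i, b))

lemma vd_apply (t : V → Z) (G : SimpleGraph V) (i : V) (b : Z) : vd t G i b = dg t G (i, b) := rfl

lemma prod_PP (t : V → Z) (G : SimpleGraph V) (hN : ∀ a, 0 < (cls t a).card) :
    FF (fun p : Z × Z => 1 / ((cls t p.1).card : ℝ)) (lk t G) * (FF (fun _ => 1) (dg t G))⁻¹ ≤
    (∏ p, Real.exp 1 * ((lk t G p : ℝ) + 1)) * ∏ i, PP t (lk t G) (t i, vd t G i) := by
  set l : Z → Z → ℝ := fun a b => (lk t G (a, b) : ℝ) / (cls t a).card with hl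
  have h1 : ∏ i, PP t (lk t G) (t i, vd t G i) =
      (∏ p : Z × Z, (Real.exp (-(lk t G p : ℝ)) * (l p.1 p.2) ^ (lk t G p))) * (FF (fun _ => 1) (dg t G))⁻¹ := by
    have e1 : ∏ i, PP t (lk t G) (t i, vd t G i) =
      (∏ i, ∏ b, Real.exp (-(l (t i) b)) * (l (t i) b) ^ (dg t G (i, b))) * (FF (fun _ => 1) (dg t G))⁻¹ := by
      have : (FF (fun _ => 1) (dg t G))⁻¹ = ∏ i, ∏ b, ((dg t G (i, b)).factorial : ℝ)⁻¹ := by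
        unfold FF
        rw [← Finset.prod_inv_distrib, Fintype.prod_prod_type]
        simp
      rw [this, ← Finset.prod_mul_distrib]
      refine Finset.prod_congr rfl fun i _ => ?_
      rw [← Finset.prod_mul_distrib]
      refine Finset.prod_congr rfl fun b _ => ?_
      simp only [poi, vd_apply, hl, div_eq_mul_inv]
    rw [e1]
    congr 1
    rw [← Finset.prod_fiberwise (s := Finset.univ) (g := t), Fintype.prod_prod_type]
    refine Finset.prod_congr rfl fun a _ => ?_
    rw [Finset.prod_comm]
    refine Finset.prod_congr rfl fun b _ => ?_
    have e2 : ∀ i ∈ Finset.univ.filter (fun i => t i = a),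
      Real.exp (-(l (t i) b)) * (l (t i) b) ^ (dg t G (i, b)) = Real.exp (-(l a b)) * (l a b) ^ (dg t G (i, b)) := by
      intro i hi
      rw [(Finset.mem_filter.1 hi).2]
    rw [Finset.prod_congr rfl e2, Finset.prod_mul_distrib, Finset.prod_pow_eq_pow_sum, Finset.prod_const]
    have e3 := lk_eq_sum t G a b
    unfold cls at e3
    rw [← e3, ← Real.exp_nat_mul]
    congr 2
    have : ((cls t a).card : ℝ) ≠ 0 := by exact_mod_cast (hN a).ne'
    change ((cls t a).card : ℝ) * -((lk t G (a, b) : ℝ) / (cls t a).card) = _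
    field_simp
  rw [h1, ← mul_assoc]
  refine mul_le_mul_of_nonneg_right ?_ (inv_nonneg.2 (FF_one_pos _).le)
  rw [← Finset.prod_mul_distrib]
  refine Finset.prod_le_prod (fun p _ => by positivity) fun p _ => ?_
  have := fact_bound (lk t G p)
  have e4 : l p.1 p.2 ^ (lk t G p) = (lk t G p : ℝ) ^ (lk t G p) * (1 / ((cls t p.1).card : ℝ)) ^ (lk t G p) := by
    rw [← mul_pow]; simp only [hl, mul_one_div]
  rw [e4]
  calc _ ≤ (Real.exp 1 * (lk t G p + 1) * (Real.exp (-(lk t G p : ℝ)) * (lk t G p : ℝ) ^ (lk t G p))) *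
        (1 / ((cls t p.1).card : ℝ)) ^ (lk t G p) := mul_le_mul_of_nonneg_right this (by positivity)
    _ = _ := by ring

lemma sum_PP_le_one (t : V → Z) (m : Z × Z → ℕ) (a : Z) (S : Finset (Z →₀ ℕ)) :
    ∑ e ∈ S, PP t m (a, e) ≤ 1 := by
  obtain ⟨K, hK⟩ : ∃ K : ℕ, ∀ e ∈ S, ∀ b, e b < K := by
    refine ⟨(S.sup fun e => ∑ b, e b) + 1, fun e he b => ?_⟩
    have h1 : e b ≤ ∑ b, e b := Finset.single_le_sum (f := fun b => e b) (fun _ _ => Nat.zero_le _) (Finset.mem_univ b)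
    have h2 := Finset.le_sup (f := fun e : Z →₀ ℕ => ∑ b, e b) he
    omega
  set Q : (Z → ℕ) → ℝ := fun u => ∏ b, poi ((m (a, b) : ℝ) / (cls t a).card) (u b)
  have hQ0 : ∀ u, 0 ≤ Q u := fun u => Finset.prod_nonneg fun b _ => poi_nonneg (by positivity) _
  calc ∑ e ∈ S, PP t m (a, e) = ∑ u ∈ S.image (fun e : Z →₀ ℕ => (e : Z → ℕ)), Q u := by
        rw [Finset.sum_image (fun x _ y _ h => DFunLike.coe_injective h)]
        rfl
    _ ≤ ∑ u ∈ Fintype.piFinset (fun _ : Z => Finset.range K), Q u := by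
        refine Finset.sum_le_sum_of_subset_of_nonneg ?_ (fun u _ _ => hQ0 u)
        intro u hu
        obtain ⟨e, he, rfl⟩ := Finset.mem_image.1 hu
        simp only [Fintype.mem_piFinset, Finset.mem_range]
        exact hK e he
    _ = ∏ b, ∑ k ∈ Finset.range K, poi ((m (a, b) : ℝ) / (cls t a).card) k := by
        rw [Finset.prod_univ_sum]
    _ ≤ 1 := by
        refine Finset.prod_le_one (fun b _ => Finset.sum_nonneg fun k _ => poi_nonneg (by positivity) _) fun b _ => ?_
        set l := (m (a, b) : ℝ) / (cls t a).card
        have hl : 0 ≤ l := by positivity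
        have : ∑ k ∈ Finset.range K, poi l k = Real.exp (-l) * ∑ k ∈ Finset.range K, l ^ k / (k.factorial : ℝ) := by
          rw [Finset.mul_sum]
          refine Finset.sum_congr rfl fun k _ => ?_
          unfold poi; ring
        rw [this]
        calc _ ≤ Real.exp (-l) * Real.exp l :=
              mul_le_mul_of_nonneg_left (Real.sum_le_exp_of_nonneg hl K) (Real.exp_pos _).le
          _ = 1 := by rw [← Real.exp_add]; simp

lemma expect_bound (t : V → Z) (m : Z × Z → ℕ) (ε : ℝ) (hε : 0 ≤ ε) (hε1 : ε < 1)
    (hN : ∀ a, 0 < (cls t a).card)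
    (hc : ∀ a b, ((cls t a).card : ℝ) + m (a, b) ≤ ε * ((cls t a).card * (cls t b).card))
    (g : Z × (Z →₀ ℕ) → ℝ) (hg : ∀ x, 0 ≤ g x) (S : Finset (Z →₀ ℕ))
    (hS : ∀ G : SimpleGraph V, ∀ i, vd t G i ∈ S) :
    ∑ G ∈ gL t m, ∏ i, g (t i, vd t G i) ≤
     (gL t m).card * (((1 - ε)⁻¹) ^ (∑ p, m p) * ∏ p, Real.exp 1 * ((m p : ℝ) + 1)) *
      ∏ i, ∑ e ∈ S, PP t m (t i, e) * g (t i, e) := by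
  have hB0 : 0 < 1 - ε := by linarith
  set B : ℝ := ((1 - ε)⁻¹) ^ (∑ p, m p) * ∏ p, Real.exp 1 * ((m p : ℝ) + 1) with hB
  have hBn : 0 ≤ B := by positivity
  rw [Finset.sum_comp (fun E : V → (Z →₀ ℕ) => ∏ i, g (t i, E i)) (vd t)]
  have h1 : ∀ E ∈ (gL t m).image (vd t), ((gL t m).filter (fun G => vd t G = E)).card • ∏ i, g (t i, E i) ≤
      (gL t m).card * B * ∏ i, PP t m (t i, E i) * g (t i, E i) := by
    intro E hE
    obtain ⟨G₀, hG₀, rfl⟩ := Finset.mem_image.1 hE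
    simp only [gL, Finset.mem_filter, Finset.mem_univ, true_and] at hG₀
    have hc1 : ((gL t m).filter (fun G => vd t G = vd t G₀)).card ≤ (gD t (dg t G₀)).card := by
      refine Finset.card_le_card fun G hG => ?_
      simp only [gD, gL, Finset.mem_filter, Finset.mem_univ, true_and] at hG ⊢
      funext ⟨i, b⟩
      rw [← vd_apply, ← vd_apply, hG.2]
    have h2 := core_bound t ε hε hε1 hN (∑ p, m p) G₀ (by rw [hG₀]) (by rw [hG₀]; exact hc)
    have h3 := prod_PP t G₀ hN
    rw [hG₀] at h2 h3
    rw [nsmul_eq_mul, Finset.prod_mul_distrib, ← mul_assoc]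
    refine mul_le_mul_of_nonneg_right ?_ (Finset.prod_nonneg fun i _ => hg _)
    calc _ ≤ ((gD t (dg t G₀)).card : ℝ) := by exact_mod_cast hc1
      _ ≤ _ := h2
      _ = (gL t m).card * ((1 - ε)⁻¹) ^ (∑ p, m p) * (FF (fun p : Z × Z => 1 / ((cls t p.1).card : ℝ)) m * (FF (fun _ => 1) (dg t G₀))⁻¹) := by ring
      _ ≤ (gL t m).card * ((1 - ε)⁻¹) ^ (∑ p, m p) * _ :=
        mul_le_mul_of_nonneg_left h3 (by positivity)
      _ = _ := by rw [hB]; ring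
  refine (Finset.sum_le_sum h1).trans ?_
  rw [← Finset.mul_sum]
  refine mul_le_mul_of_nonneg_left ?_ (by positivity)
  rw [Finset.prod_univ_sum]
  refine Finset.sum_le_sum_of_subset_of_nonneg ?_ ?_
  · intro E hE
    obtain ⟨G₀, hG₀, rfl⟩ := Finset.mem_image.1 hE
    simp only [Fintype.mem_piFinset]
    exact hS G₀
  · intro E _ _
    exact Finset.prod_nonneg fun i _ => mul_nonneg (PP_nonneg _ _ _) (hg _)

lemma expect_bound2 (t : V → Z) (m : Z × Z → ℕ) (ε : ℝ) (hε : 0 ≤ ε) (hε1 : ε < 1)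
    (hN : ∀ a, 0 < (cls t a).card)
    (hc : ∀ a b, ((cls t a).card : ℝ) + m (a, b) ≤ ε * ((cls t a).card * (cls t b).card))
    (F : Finset (Z × (Z →₀ ℕ))) (f : Z × (Z →₀ ℕ) → ℝ) :
    ∑ G ∈ gL t m, Real.exp (∑ x ∈ F, f x *
        ((Finset.univ.filter (fun i => (t i, vd t G i) = x)).card : ℝ)) ≤
     (gL t m).card * (((1 - ε)⁻¹) ^ (∑ p, m p) * ∏ p, Real.exp 1 * ((m p : ℝ) + 1)) *
      Real.exp (∑ x ∈ F, ((cls t x.1).card * PP t m x) * (Real.exp (f x) - 1)) := by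
  have hB0 : 0 < 1 - ε := by linarith
  set S : Finset (Z →₀ ℕ) := F.image Prod.snd ∪
    (Finset.univ : Finset (SimpleGraph V × V)).image (fun y => vd t y.1 y.2) with hSdef
  set g : Z × (Z →₀ ℕ) → ℝ := fun x => if x ∈ F then Real.exp (f x) else 1 with hg
  have hg0 : ∀ x, 0 ≤ g x := by
    intro x; simp only [hg]; split_ifs <;> positivity
  have h := expect_bound t m ε hε hε1 hN hc g hg0 S (fun G i => by
    rw [hSdef]
    refine Finset.mem_union_right _ (Finset.mem_image.2 ⟨(G, i), Finset.mem_univ _, rfl⟩))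
  have hL : ∀ G : SimpleGraph V, ∏ i, g (t i, vd t G i) = Real.exp (∑ x ∈ F, f x *
        ((Finset.univ.filter (fun i => (t i, vd t G i) = x)).card : ℝ)) := by
    intro G
    have : ∀ i, g (t i, vd t G i) = Real.exp (∑ x ∈ F, if (t i, vd t G i) = x then f x else 0) := by
      intro i
      rw [Finset.sum_ite_eq]
      simp only [hg]
      split_ifs <;> simp
    rw [Finset.prod_congr rfl (fun i _ => this i), ← Real.exp_sum, Finset.sum_comm]
    congr 1
    refine Finset.sum_congr rfl fun x _ => ?_
    rw [← Finset.sum_filter, Finset.sum_const, nsmul_eq_mul, mul_comm]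
  simp_rw [hL] at h
  refine h.trans (mul_le_mul_of_nonneg_left ?_ (by positivity))
  have hi : ∀ i, ∑ e ∈ S, PP t m (t i, e) * g (t i, e) ≤
      Real.exp (∑ x ∈ F, if t i = x.1 then PP t m x * (Real.exp (f x) - 1) else 0) := by
    intro i
    have e1 : ∑ e ∈ S, PP t m (t i, e) * g (t i, e) = ∑ e ∈ S, PP t m (t i, e) +
       ∑ e ∈ S, PP t m (t i, e) * (g (t i, e) - 1) := by
      rw [← Finset.sum_add_distrib]
      refine Finset.sum_congr rfl fun e _ => by ring
    have e2 : ∑ e ∈ S, PP t m (t i, e) * (g (t i, e) - 1) =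
        ∑ x ∈ F, if t i = x.1 then PP t m x * (Real.exp (f x) - 1) else 0 := by
      have e3 : ∀ e ∈ S, PP t m (t i, e) * (g (t i, e) - 1) =
          ∑ x ∈ F, if (t i, e) = x then PP t m x * (Real.exp (f x) - 1) else 0 := by
        intro e _
        rw [Finset.sum_ite_eq]
        simp only [hg]
        split_ifs <;> simp
      rw [Finset.sum_congr rfl e3, Finset.sum_comm]
      refine Finset.sum_congr rfl fun x hx => ?_
      by_cases hxi : t i = x.1
      · rw [if_pos hxi, Finset.sum_eq_single x.2]
        · rw [if_pos]; rw [hxi]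
        · intro e _ hne
          rw [if_neg]; rintro rfl; exact hne rfl
        · intro hn
          exact absurd (Finset.mem_union_left _ (Finset.mem_image_of_mem _ hx)) hn
      · rw [if_neg hxi]
        refine Finset.sum_eq_zero fun e _ => ?_
        rw [if_neg]; rintro rfl; exact hxi rfl
    rw [e1, e2]
    have := sum_PP_le_one t m (t i) S
    have h5 := Real.add_one_le_exp (∑ x ∈ F, if t i = x.1 then PP t m x * (Real.exp (f x) - 1) else 0)
    linarith
  refine (Finset.prod_le_prod (fun i _ => Finset.sum_nonneg fun e _ =>
    mul_nonneg (PP_nonneg _ _ _) (hg0 _)) (fun i _ => hi i)).trans ?_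
  rw [← Real.exp_sum, Finset.sum_comm]
  refine le_of_eq ?_
  congr 1
  refine Finset.sum_congr rfl fun x _ => ?_
  rw [← Finset.sum_filter, Finset.sum_const, nsmul_eq_mul]
  unfold cls
  ring

end poisson

section link

noncomputable def tgEquiv (n : ℕ) (Z : Type) : TypedGraph n Z ≃ (Fin n → Z) × SimpleGraph (Fin n) where
  toFun z := (z.type, z.graph)
  invFun p := ⟨p.1, p.2⟩
  left_inv _ := rfl
  right_inv _ := rfl

noncomputable instance tgFintype (n : ℕ) : Fintype (TypedGraph n Z) := Fintype.ofEquiv _ (tgEquiv n Z).symm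

lemma typeMeasure_eq {n : ℕ} (z : TypedGraph n Z) (a : Z) :
    typeMeasure z a = ((cls z.type a).card : ℝ) / n := by
  unfold typeMeasure cls
  rw [Nat.card_eq_fintype_card, Fintype.card_subtype]

lemma linkMeasure_eq {n : ℕ} (z : TypedGraph n Z) (a b : Z) :
    linkMeasure z a b = (lk z.type z.graph (a, b) : ℝ) / n := by
  unfold linkMeasure
  rw [Nat.card_eq_fintype_card, Fintype.card_subtype, lk_eq_card]
  congr 3
  ext ⟨i, j⟩
  simp only [cls, Finset.mem_filter, Finset.mem_product, Finset.mem_univ, true_and]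
  tauto

lemma localityMeasure_eq {n : ℕ} (z : TypedGraph n Z) (x : Z × (Z →₀ ℕ)) :
    localityMeasure z x =
      ((Finset.univ.filter (fun i => (z.type i, vd z.type z.graph i) = x)).card : ℝ) / n := by
  unfold localityMeasure
  rw [Nat.card_eq_fintype_card, Fintype.card_subtype]
  congr 3
  ext i
  obtain ⟨a, e⟩ := x
  have : ∀ b, Nat.card {j : Fin n // z.graph.Adj i j ∧ z.type j = b} = vd z.type z.graph i b := by
    intro b
    rw [vd_apply, dg, Nat.card_eq_fintype_card, Fintype.card_subtype, Finset.card_filter]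
  simp only [this, Finset.mem_filter, Finset.mem_univ, true_and, Prod.mk.injEq]
  rw [← DFunLike.ext_iff]

noncomputable def TT (n : ℕ) (ηn : Z → ℝ) (πn : Z → Z → ℝ) : Finset (TypedGraph n Z) :=
  Finset.univ.filter (fun z => typeMeasure z = ηn ∧ linkMeasure z = πn)

lemma sum_TT (n : ℕ) (hn : 0 < n) (ηn : Z → ℝ) (πn : Z → Z → ℝ) (z₀ : TypedGraph n Z)
    (h₀ : typeMeasure z₀ = ηn ∧ linkMeasure z₀ = πn) (Φ : TypedGraph n Z → ℝ) :
    ∑ z ∈ TT n ηn πn, Φ z = ∑ t ∈ Finset.univ.filter (fun t : Fin n → Z => ∀ a, (cls t a).card = (cls z₀.type a).card),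
      ∑ G ∈ gL t (lk z₀.type z₀.graph), Φ ⟨t, G⟩ := by
  have hn' : (n : ℝ) ≠ 0 := by exact_mod_cast hn.ne'
  have key : ∀ z : TypedGraph n Z, (typeMeasure z = ηn ∧ linkMeasure z = πn) ↔
      ((∀ a, (cls z.type a).card = (cls z₀.type a).card) ∧ lk z.type z.graph = lk z₀.type z₀.graph) := by
    intro z
    rw [← h₀.1, ← h₀.2]
    refine and_congr ?_ ?_
    · rw [funext_iff]
      refine forall_congr' fun a => ?_
      rw [typeMeasure_eq, typeMeasure_eq, div_left_inj' hn', Nat.cast_inj]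
    · constructor
      · intro h
        funext ⟨a, b⟩
        have := congrFun (congrFun h a) b
        rw [linkMeasure_eq, linkMeasure_eq, div_left_inj' hn', Nat.cast_inj] at this
        exact this
      · intro h
        funext a b
        rw [linkMeasure_eq, linkMeasure_eq, h]
  unfold TT
  rw [Finset.sum_filter, ← (tgEquiv n Z).symm.sum_comp, Fintype.sum_prod_type, Finset.sum_filter]
  refine Finset.sum_congr rfl fun t _ => ?_
  have hs : ∀ G, (tgEquiv n Z).symm (t, G) = ⟨t, G⟩ := fun _ => rfl
  simp only [hs, key]
  by_cases ht : ∀ a, (cls t a).card = (cls z₀.type a).card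
  · rw [if_pos ht]
    unfold gL
    rw [Finset.sum_filter]
    refine Finset.sum_congr (by ext G; simp only [Finset.mem_univ]) fun G _ => ?_
    by_cases hG : lk t G = lk z₀.type z₀.graph
    · rw [if_pos hG, if_pos ⟨ht, hG⟩]
    · rw [if_neg hG, if_neg (fun h => hG h.2)]
  · rw [if_neg ht]
    refine Finset.sum_eq_zero fun G _ => ?_
    rw [if_neg]
    exact fun h => ht h.1

lemma expectD (n : ℕ) (hn : 0 < n) (ηn : Z → ℝ) (πn : Z → Z → ℝ)
    (hach : ∃ z : TypedGraph n Z, typeMeasure z = ηn ∧ linkMeasure z = πn)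
    (hpos : ∀ a, 0 < ηn a) (ε : ℝ) (hε : 0 ≤ ε) (hε1 : ε < 1)
    (hc : ∀ a b, ηn a + πn a b ≤ ε * n * (ηn a * ηn b))
    (F : Finset (Z × (Z →₀ ℕ))) (f : Z × (Z →₀ ℕ) → ℝ) :
    ∑ z ∈ TT n ηn πn, Real.exp (n * ∑ x ∈ F, f x * localityMeasure z x) ≤
      (TT n ηn πn).card * (Real.exp (-Real.log (1 - ε) * (n * ∑ p : Z × Z, πn p.1 p.2)) *
        ∏ p : Z × Z, Real.exp 1 * (n * πn p.1 p.2 + 1)) *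
      Real.exp (n * ∑ x ∈ F, qMeasure ηn πn x * (Real.exp (f x) - 1)) := by
  obtain ⟨z₀, h₀⟩ := hach
  have hn' : (n : ℝ) ≠ 0 := by exact_mod_cast hn.ne'
  have hn0 : (0:ℝ) < n := by exact_mod_cast hn
  have hB0 : 0 < 1 - ε := by linarith
  have hcard : ((TT n ηn πn).card : ℝ) = ∑ t ∈ Finset.univ.filter (fun t : Fin n → Z => ∀ a, (cls t a).card = (cls z₀.type a).card),
      ((gL t (lk z₀.type z₀.graph)).card : ℝ) := by
    have := sum_TT n hn ηn πn z₀ h₀ (fun _ => 1)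
    simpa using this
  have hη : ∀ a, ((cls z₀.type a).card : ℝ) = n * ηn a := by
    intro a
    rw [← h₀.1, typeMeasure_eq]; field_simp
  have hπ : ∀ a b, (lk z₀.type z₀.graph (a, b) : ℝ) = n * πn a b := by
    intro a b
    rw [← h₀.2, linkMeasure_eq]; field_simp
  rw [sum_TT n hn ηn πn z₀ h₀, hcard, Finset.sum_mul, Finset.sum_mul]
  refine Finset.sum_le_sum fun t ht => ?_
  simp only [Finset.mem_filter, Finset.mem_univ, true_and] at ht
  set m := lk z₀.type z₀.graph with hm
  have hηt : ∀ a, ((cls t a).card : ℝ) = n * ηn a := by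
    intro a; rw [ht]; exact hη a
  have h := expect_bound2 t m ε hε hε1 (fun a => by
      have : (0:ℝ) < (cls t a).card := by rw [hηt]; exact mul_pos hn0 (hpos a)
      exact_mod_cast this) (fun a b => by
      rw [hηt, hηt, hπ]
      have := mul_le_mul_of_nonneg_left (hc a b) hn0.le
      linarith) F f
  have e1 : ∀ G, Real.exp (n * ∑ x ∈ F, f x * localityMeasure (⟨t, G⟩ : TypedGraph n Z) x) =
     Real.exp (∑ x ∈ F, f x *
        ((Finset.univ.filter (fun i => (t i, vd t G i) = x)).card : ℝ)) := by
    intro G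
    rw [Finset.mul_sum]
    congr 1
    refine Finset.sum_congr rfl fun x _ => ?_
    rw [localityMeasure_eq]
    field_simp
  have e2 : ((1 - ε)⁻¹) ^ (∑ p, m p) = Real.exp (-Real.log (1 - ε) * (n * ∑ p : Z × Z, πn p.1 p.2)) := by
    have : (n * ∑ p : Z × Z, πn p.1 p.2) = ((∑ p, m p : ℕ) : ℝ) := by
      rw [Finset.mul_sum]
      push_cast
      refine Finset.sum_congr rfl fun p _ => (hπ _ _).symm
    rw [this, ← Real.log_inv, mul_comm, Real.exp_nat_mul, Real.exp_log (by positivity)]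
  have e3 : ∏ p, Real.exp 1 * ((m p : ℝ) + 1) = ∏ p : Z × Z, Real.exp 1 * (n * πn p.1 p.2 + 1) := by
    refine Finset.prod_congr rfl fun p _ => ?_
    rw [← hπ]
  have e4 : ∀ x, ((cls t x.1).card * PP t m x) = n * qMeasure ηn πn x := by
    intro x
    unfold PP qMeasure
    rw [hηt, mul_assoc]
    congr 2
    refine Finset.prod_congr rfl fun b _ => ?_
    unfold poi
    rw [hπ, mul_div_mul_left _ _ hn', neg_div]
  simp only [e1]
  rw [e2, e3] at h
  refine h.trans (le_of_eq ?_)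
  congr 2
  rw [Finset.mul_sum]
  refine Finset.sum_congr rfl fun x _ => ?_
  rw [e4]; ring

end link

section asym

lemma poly_le_exp (C s : ℝ) (hC : 0 ≤ C) (hs : 0 < s) :
    ∀ᶠ n : ℕ in atTop, Real.exp 1 * ((n : ℝ) * C + 1) ≤ Real.exp (n * s) := by
  filter_upwards [eventually_ge_atTop (max 1 ⌈2 * Real.exp 1 * (C + 1) / s ^ 2⌉₊)] with n hn
  have h1 : (1:ℝ) ≤ n := by exact_mod_cast (le_max_left _ _).trans hn
  have h2 : 2 * Real.exp 1 * (C + 1) / s ^ 2 ≤ n :=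
    (Nat.le_ceil _).trans (by exact_mod_cast (le_max_right _ _).trans hn)
  rw [div_le_iff₀ (by positivity)] at h2
  have h3 := Real.quadratic_le_exp_of_nonneg (x := n * s) (by positivity)
  have h4 : (n:ℝ) * (2 * Real.exp 1 * (C + 1)) ≤ n * (n * s ^ 2) := mul_le_mul_of_nonneg_left h2 (by positivity)
  have h5 : (0:ℝ) ≤ n * s := by positivity
  have h6 : Real.exp 1 ≤ Real.exp 1 * n := le_mul_of_one_le_right (Real.exp_pos _).le h1
  nlinarith

lemma link_nonneg {n : ℕ} (z : TypedGraph n Z) (a b : Z) : 0 ≤ linkMeasure z a b := by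
  rw [linkMeasure_eq]; positivity

lemma exp_upper
    (η : Z → ℝ) (π : Z → Z → ℝ) (ηn : ℕ → Z → ℝ) (πn : ℕ → Z → Z → ℝ)
    (hach : ∀ n : ℕ, ∃ z : TypedGraph n Z, typeMeasure z = ηn n ∧ linkMeasure z = πn n)
    (hηpos : ∀ a, 0 < η a) (hπnonneg : ∀ a b, 0 ≤ π a b)
    (hηconv : ∀ a, Tendsto (fun n => ηn n a) atTop (nhds (η a)))
    (hπconv : ∀ a b, Tendsto (fun n => πn n a b) atTop (nhds (π a b)))
    (F : Finset (Z × (Z →₀ ℕ))) (f : Z × (Z →₀ ℕ) → ℝ) (δ : ℝ) (hδ : 0 < δ) :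
    ∀ᶠ n : ℕ in atTop, ∑ z ∈ TT n (ηn n) (πn n), Real.exp (n * ∑ x ∈ F, f x * localityMeasure z x) ≤
      (TT n (ηn n) (πn n)).card *
      Real.exp (n * (∑ x ∈ F, qMeasure η π x * (Real.exp (f x) - 1) + δ)) := by
  set Cp : ℝ := ∑ p : Z × Z, π p.1 p.2 + 1 with hCp
  have hCp0 : 0 < Cp := by
    have : 0 ≤ ∑ p : Z × Z, π p.1 p.2 := Finset.sum_nonneg fun p _ => hπnonneg _ _
    linarith
  set s : ℝ := δ / (3 * Cp) with hs
  have hs0 : 0 < s := by positivity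
  set ε : ℝ := 1 - Real.exp (-s) with hε
  have hε0 : 0 < ε := by
    have : Real.exp (-s) < 1 := Real.exp_lt_one_iff.2 (by linarith)
    linarith
  have hε1 : ε < 1 := by
    have := Real.exp_pos (-s)
    linarith
  have hlog : -Real.log (1 - ε) = s := by
    rw [hε]; simp
  set c : ℕ := Fintype.card (Z × Z) with hc
  set s' : ℝ := δ / (3 * (c + 1)) with hs'
  have hs'0 : 0 < s' := by positivity
  have ev1 : ∀ᶠ n : ℕ in atTop, ∀ a, 0 < ηn n a := by
    rw [eventually_all]; intro a
    exact (hηconv a).eventually_const_lt (hηpos a)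
  have ev2 : ∀ᶠ n : ℕ in atTop, ∀ a b, ηn n a + πn n a b ≤ ε * n * (ηn n a * ηn n b) := by
    rw [eventually_all]; intro a
    rw [eventually_all]; intro b
    have t1 : Tendsto (fun n : ℕ => (ηn n a + πn n a b) / n) atTop (nhds 0) :=
      ((hηconv a).add (hπconv a b)).div_atTop tendsto_natCast_atTop_atTop
    have t2 : Tendsto (fun n : ℕ => ε * (ηn n a * ηn n b)) atTop (nhds (ε * (η a * η b))) :=
      ((hηconv a).mul (hηconv b)).const_mul ε
    have hp : 0 < ε * (η a * η b) := mul_pos hε0 (mul_pos (hηpos a) (hηpos b))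
    filter_upwards [t1.eventually_lt t2 hp, eventually_gt_atTop 0] with n hn hn0
    have hn0' : (0:ℝ) < n := by exact_mod_cast hn0
    rw [div_lt_iff₀ hn0'] at hn
    linarith
  have ev3 : ∀ᶠ n : ℕ in atTop, ∑ p : Z × Z, πn n p.1 p.2 ≤ Cp := by
    have t : Tendsto (fun n => ∑ p : Z × Z, πn n p.1 p.2) atTop (nhds (∑ p : Z × Z, π p.1 p.2)) :=
      tendsto_finsetSum _ fun p _ => hπconv _ _
    filter_upwards [t.eventually_lt_const (u := Cp) (by linarith)] with n hn using hn.le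
  have ev4 : ∀ᶠ n : ℕ in atTop, ∀ p : Z × Z, Real.exp 1 * (n * πn n p.1 p.2 + 1) ≤ Real.exp (n * s') := by
    rw [eventually_all]; intro p
    filter_upwards [poly_le_exp (π p.1 p.2 + 1) s' (by have := hπnonneg p.1 p.2; linarith) hs'0,
      (hπconv p.1 p.2).eventually_lt_const (u := π p.1 p.2 + 1) (by linarith)] with n h1 h2
    refine le_trans ?_ h1
    gcongr
  have ev5 : ∀ᶠ n : ℕ in atTop, ∑ x ∈ F, qMeasure (ηn n) (πn n) x * (Real.exp (f x) - 1) ≤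
      ∑ x ∈ F, qMeasure η π x * (Real.exp (f x) - 1) + δ / 3 := by
    have t : Tendsto (fun n => ∑ x ∈ F, qMeasure (ηn n) (πn n) x * (Real.exp (f x) - 1)) atTop
        (nhds (∑ x ∈ F, qMeasure η π x * (Real.exp (f x) - 1))) := by
      refine tendsto_finsetSum _ fun x _ => ?_
      refine Tendsto.mul_const _ ?_
      unfold qMeasure
      refine (hηconv x.1).mul (tendsto_finsetProd _ fun b _ => ?_)
      refine Tendsto.div_const (Tendsto.mul ?_ ?_) _
      · exact (Real.continuous_exp.tendsto _).comp ((hπconv _ _).neg.div (hηconv _) (hηpos _).ne')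
      · exact ((hπconv _ _).div (hηconv _) (hηpos _).ne').pow _
    filter_upwards [t.eventually_lt_const (u := ∑ x ∈ F, qMeasure η π x * (Real.exp (f x) - 1) + δ / 3)
      (by linarith)] with n hn using hn.le
  filter_upwards [ev1, ev2, ev3, ev4, ev5, eventually_gt_atTop 0] with n h1 h2 h3 h4 h5 hn
  have hn0 : (0:ℝ) < n := by exact_mod_cast hn
  refine (expectD n hn (ηn n) (πn n) (hach n) h1 ε hε0.le hε1 h2 F f).trans ?_
  rw [hlog, mul_assoc]
  refine mul_le_mul_of_nonneg_left ?_ (by positivity)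
  have hπ0 : ∀ a b, 0 ≤ πn n a b := by
    intro a b
    obtain ⟨z, hz⟩ := hach n
    rw [← hz.2]; exact link_nonneg z a b
  have b1 : Real.exp (s * (n * ∑ p : Z × Z, πn n p.1 p.2)) ≤ Real.exp (n * (δ / 3)) := by
    rw [Real.exp_le_exp]
    have : s * (n * ∑ p : Z × Z, πn n p.1 p.2) ≤ s * (n * Cp) := by gcongr
    refine this.trans (le_of_eq ?_)
    rw [hs]; field_simp
  have b2 : ∏ p : Z × Z, Real.exp 1 * (n * πn n p.1 p.2 + 1) ≤ Real.exp (n * (δ / 3)) := by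
    calc _ ≤ ∏ p : Z × Z, Real.exp (n * s') :=
          Finset.prod_le_prod (fun p _ => by have := hπ0 p.1 p.2; positivity) (fun p _ => h4 p)
      _ = Real.exp (c * (n * s')) := by
          rw [Finset.prod_const, Finset.card_univ, ← hc, ← Real.exp_nat_mul]
      _ ≤ _ := by
          rw [Real.exp_le_exp]
          have : (c:ℝ) * s' ≤ δ / 3 := by
            rw [hs', mul_div_assoc', div_le_div_iff₀ (by positivity) (by positivity)]
            nlinarith
          nlinarith
  have b3 : Real.exp (n * ∑ x ∈ F, qMeasure (ηn n) (πn n) x * (Real.exp (f x) - 1)) ≤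
     Real.exp (n * (∑ x ∈ F, qMeasure η π x * (Real.exp (f x) - 1) + δ / 3)) := by
    rw [Real.exp_le_exp]
    exact mul_le_mul_of_nonneg_left h5 hn0.le
  calc _ ≤ Real.exp (n * (δ / 3)) * Real.exp (n * (δ / 3)) *
        Real.exp (n * (∑ x ∈ F, qMeasure η π x * (Real.exp (f x) - 1) + δ / 3)) := by
        refine mul_le_mul (mul_le_mul b1 b2 ?_ (Real.exp_pos _).le) b3 (Real.exp_pos _).le (by positivity)
        exact Finset.prod_nonneg fun p _ => by have := hπ0 p.1 p.2; positivity
    _ = _ := by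
        rw [← Real.exp_add, ← Real.exp_add]; congr 1; ring

lemma condProb_eq (n : ℕ) (ηn : Z → ℝ) (πn : Z → Z → ℝ) (A : Set (TypedGraph n Z)) :
    condProb n ηn πn A = (((TT n ηn πn).filter (fun z => z ∈ A)).card : ℝ≥0∞) / ((TT n ηn πn).card : ℝ≥0∞) := by
  unfold condProb TT
  rw [Nat.card_eq_fintype_card, Fintype.card_subtype, Nat.card_eq_fintype_card, Fintype.card_subtype,
    Finset.filter_filter]

lemma condProb_le (n : ℕ) (ηn : Z → ℝ) (πn : Z → Z → ℝ) (A : Set (TypedGraph n Z)) (r : ℝ) (hr : 0 ≤ r)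
    (h : (((TT n ηn πn).filter (fun z => z ∈ A)).card : ℝ) ≤ (TT n ηn πn).card * r) :
    condProb n ηn πn A ≤ ENNReal.ofReal r := by
  rw [condProb_eq]
  refine ENNReal.div_le_of_le_mul ?_
  rw [← ENNReal.ofReal_natCast, ← ENNReal.ofReal_natCast (TT n ηn πn).card, ← ENNReal.ofReal_mul hr]
  refine ENNReal.ofReal_le_ofReal ?_
  linarith

/-- exponentially small at rate `α` -/
def Good (ηn : ℕ → Z → ℝ) (πn : ℕ → Z → Z → ℝ) (α : ℝ) (U : Set ((Z × (Z →₀ ℕ)) → ℝ)) : Prop :=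
  ∃ C : ℝ, 0 ≤ C ∧ ∀ᶠ n : ℕ in atTop, (((TT n (ηn n) (πn n)).filter (fun z => localityMeasure z ∈ U)).card : ℝ)
    ≤ (TT n (ηn n) (πn n)).card * (C * Real.exp (-(n * α)))

lemma good_exp
    (η : Z → ℝ) (π : Z → Z → ℝ) (ηn : ℕ → Z → ℝ) (πn : ℕ → Z → Z → ℝ)
    (hach : ∀ n : ℕ, ∃ z : TypedGraph n Z, typeMeasure z = ηn n ∧ linkMeasure z = πn n)
    (hηpos : ∀ a, 0 < η a) (hπnonneg : ∀ a b, 0 ≤ π a b)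
    (hηconv : ∀ a, Tendsto (fun n => ηn n a) atTop (nhds (η a)))
    (hπconv : ∀ a b, Tendsto (fun n => πn n a b) atTop (nhds (π a b)))
    (F : Finset (Z × (Z →₀ ℕ))) (f : Z × (Z →₀ ℕ) → ℝ) (α : ℝ) (p : Z × (Z →₀ ℕ) → ℝ)
    (h : α < ∑ x ∈ F, (p x * f x - qMeasure η π x * (Real.exp (f x) - 1))) :
    ∃ U ∈ nhds p, Good ηn πn α U := by
  set A := ∑ x ∈ F, qMeasure η π x * (Real.exp (f x) - 1) with hA
  have h' : α + A < ∑ x ∈ F, f x * p x := by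
    rw [Finset.sum_sub_distrib] at h
    have : ∑ x ∈ F, p x * f x = ∑ x ∈ F, f x * p x := Finset.sum_congr rfl fun x _ => mul_comm _ _
    linarith
  obtain ⟨r, hr1, hr2⟩ := exists_between h'
  refine ⟨{p' | r < ∑ x ∈ F, f x * p' x}, ?_, 1, zero_le_one, ?_⟩
  · refine IsOpen.mem_nhds ?_ hr2
    refine isOpen_lt continuous_const ?_
    fun_prop
  have := exp_upper η π ηn πn hach hηpos hπnonneg hηconv hπconv F f (r - (α + A)) (by linarith)
  filter_upwards [this] with n hn
  have h1 : (((TT n (ηn n) (πn n)).filter (fun z => localityMeasure z ∈ {p' | r < ∑ x ∈ F, f x * p' x})).card : ℝ) *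
      Real.exp (n * r) ≤ ∑ z ∈ TT n (ηn n) (πn n), Real.exp (n * ∑ x ∈ F, f x * localityMeasure z x) := by
    rw [← nsmul_eq_mul, ← Finset.sum_const]
    refine le_trans ?_ (Finset.sum_le_sum_of_subset_of_nonneg
      (Finset.filter_subset (fun z => localityMeasure z ∈ {p' | r < ∑ x ∈ F, f x * p' x}) _)
      (fun z _ _ => (Real.exp_pos _).le))
    refine Finset.sum_le_sum fun z hz => ?_
    have : r < ∑ x ∈ F, f x * localityMeasure z x := (Finset.mem_filter.1 hz).2
    rw [Real.exp_le_exp]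
    exact mul_le_mul_of_nonneg_left this.le (Nat.cast_nonneg _)
  have h2 := h1.trans hn
  have e : (n:ℝ) * (A + (r - (α + A))) = -(n * α) + n * r := by ring
  rw [e, Real.exp_add, ← mul_assoc] at h2
  rw [one_mul]
  exact le_of_mul_le_mul_right h2 (Real.exp_pos _)

lemma good_det (ηn : ℕ → Z → ℝ) (πn : ℕ → Z → Z → ℝ) (α : ℝ) (U : Set ((Z × (Z →₀ ℕ)) → ℝ))
    (h : ∀ᶠ n : ℕ in atTop, ∀ z ∈ TT n (ηn n) (πn n), localityMeasure z ∉ U) : Good ηn πn α U := by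
  refine ⟨0, le_rfl, ?_⟩
  filter_upwards [h] with n hn
  rw [Finset.filter_false_of_mem hn]
  simp

end asym

section det

lemma loc_sum {n : ℕ} (z : TypedGraph n Z) (a : Z) (S : Finset (Z →₀ ℕ)) (h : (Z →₀ ℕ) → ℝ) :
    ∑ e ∈ S, localityMeasure z (a, e) * h e =
      (∑ i ∈ cls z.type a, if vd z.type z.graph i ∈ S then h (vd z.type z.graph i) else 0) / n := by
  have : ∀ e ∈ S, localityMeasure z (a, e) * h e =
      (∑ i ∈ cls z.type a, if vd z.type z.graph i = e then h (vd z.type z.graph i) else 0) / n := by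
    intro e _
    rw [localityMeasure_eq, ← Finset.sum_filter]
    have e2 : (cls z.type a).filter (fun i => vd z.type z.graph i = e) =
        Finset.univ.filter (fun i => (z.type i, vd z.type z.graph i) = (a, e)) := by
      ext i
      simp [cls]
    rw [e2, Finset.sum_congr rfl (g := fun _ => h e), Finset.sum_const, nsmul_eq_mul]
    · ring
    · intro i hi
      simp only [Finset.mem_filter, Prod.mk.injEq] at hi
      rw [hi.2.2]
  rw [Finset.sum_congr rfl this, ← Finset.sum_div, Finset.sum_comm]
  congr 1
  refine Finset.sum_congr rfl fun i _ => ?_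
  rw [Finset.sum_ite_eq]

lemma loc_nonneg {n : ℕ} (z : TypedGraph n Z) (x : Z × (Z →₀ ℕ)) : 0 ≤ localityMeasure z x := by
  rw [localityMeasure_eq]; positivity

lemma loc_le_one {n : ℕ} (z : TypedGraph n Z) (x : Z × (Z →₀ ℕ)) : localityMeasure z x ≤ 1 := by
  rw [localityMeasure_eq]
  refine div_le_one_of_le₀ ?_ (Nat.cast_nonneg _)
  have := Finset.card_le_univ (Finset.univ.filter (fun i => (z.type i, vd z.type z.graph i) = x))
  rw [Fintype.card_fin] at this
  exact_mod_cast this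

lemma loc_link {n : ℕ} (z : TypedGraph n Z) (a b : Z) (S : Finset (Z →₀ ℕ)) :
    ∑ e ∈ S, localityMeasure z (a, e) * (e b : ℝ) ≤ linkMeasure z a b := by
  rw [loc_sum z a S (fun e => (e b : ℝ)), linkMeasure_eq, lk_eq_sum]
  push_cast
  refine div_le_div_of_nonneg_right ?_ (Nat.cast_nonneg _)
  refine Finset.sum_le_sum fun i _ => ?_
  split_ifs
  · rw [vd_apply]
  · positivity

lemma loc_type {n : ℕ} (z : TypedGraph n Z) (a : Z) (S : Finset (Z →₀ ℕ)) :
    ∑ e ∈ S, localityMeasure z (a, e) ≤ typeMeasure z a := by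
  have := loc_sum z a S (fun e => 1)
  simp only [mul_one] at this
  rw [this, typeMeasure_eq]
  refine div_le_div_of_nonneg_right ?_ (Nat.cast_nonneg _)
  rw [← nsmul_one, ← Finset.sum_const]
  refine Finset.sum_le_sum fun i _ => ?_
  split_ifs <;> simp

/-- localities with all entries at most `R` -/
noncomputable def SR (Z : Type) [Fintype Z] (R : ℕ) : Finset (Z →₀ ℕ) :=
  (Fintype.piFinset (fun _ : Z => Finset.range (R + 1))).image (fun g => Finsupp.equivFunOnFinite.symm g)

lemma mem_SR (R : ℕ) (e : Z →₀ ℕ) : e ∈ SR Z R ↔ ∀ b, e b ≤ R := by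
  unfold SR
  simp only [Finset.mem_image, Fintype.mem_piFinset, Finset.mem_range, Nat.lt_succ_iff]
  constructor
  · rintro ⟨g, hg, rfl⟩ b
    exact hg b
  · intro h
    exact ⟨fun b => e b, h, by ext; rfl⟩

lemma loc_tight {n : ℕ} (z : TypedGraph n Z) (a : Z) (R : ℕ) :
    typeMeasure z a ≤ ∑ e ∈ SR Z R, localityMeasure z (a, e) + ∑ b, linkMeasure z a b / (R + 1) := by
  have := loc_sum z a (SR Z R) (fun e => 1)
  simp only [mul_one] at this
  rw [this, typeMeasure_eq]
  simp only [linkMeasure_eq, lk_eq_sum]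
  have e1 : ∀ b, ((∑ i ∈ cls z.type a, dg z.type z.graph (i, b) : ℕ) : ℝ) / n / (R + 1) =
     (∑ i ∈ cls z.type a, (dg z.type z.graph (i, b) : ℝ) / (R + 1)) / n := by
    intro b
    push_cast
    rw [div_right_comm, Finset.sum_div]
  simp only [e1]
  rw [← Finset.sum_div, ← add_div, Finset.sum_comm, ← Finset.sum_add_distrib]
  refine div_le_div_of_nonneg_right ?_ (Nat.cast_nonneg _)
  rw [← nsmul_one, ← Finset.sum_const]
  refine Finset.sum_le_sum fun i _ => ?_
  have hs : ∀ b ∈ Finset.univ, 0 ≤ (dg z.type z.graph (i, b) : ℝ) / (R + 1) := fun b _ => by positivity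
  split_ifs with h
  · have := Finset.sum_nonneg hs
    linarith
  · rw [mem_SR] at h
    push Not at h
    obtain ⟨b, hb⟩ := h
    rw [vd_apply] at hb
    have h1 := Finset.single_le_sum hs (Finset.mem_univ b)
    have h2 : 1 ≤ (dg z.type z.graph (i, b) : ℝ) / (R + 1) := by
      rw [le_div_iff₀ (by positivity), one_mul]
      exact_mod_cast hb
    linarith

lemma q_nonneg (η : Z → ℝ) (π : Z → Z → ℝ) (hηpos : ∀ a, 0 < η a) (hπnonneg : ∀ a b, 0 ≤ π a b)
    (x : Z × (Z →₀ ℕ)) : 0 ≤ qMeasure η π x := by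
  unfold qMeasure
  have h1 := hηpos x.1
  refine mul_nonneg h1.le (Finset.prod_nonneg fun b _ => ?_)
  have := hπnonneg x.1 b
  positivity

lemma term_approx (p q : ℝ) (hp : 0 ≤ p) (hq : 0 ≤ q) (h : q = 0 → p = 0) (ε : ℝ) (hε : 0 < ε) :
    ∃ f : ℝ, p * Real.log (p / q) - p + q - ε < p * f - q * (Real.exp f - 1) := by
  rcases hp.eq_or_lt with hp | hp
  · subst hp
    obtain ⟨f, hf⟩ : ∃ f : ℝ, q * Real.exp f < ε := by
      have t : Tendsto (fun f : ℝ => q * Real.exp f) atBot (nhds (q * 0)) :=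
        Real.tendsto_exp_atBot.const_mul q
      rw [mul_zero] at t
      exact (t.eventually_lt_const hε).exists
    refine ⟨f, ?_⟩
    simp only [zero_mul]
    linarith
  · have hq' : 0 < q := lt_of_le_of_ne hq (fun hh => hp.ne' (h hh.symm))
    refine ⟨Real.log (p / q), ?_⟩
    rw [Real.exp_log (by positivity)]
    have : q * (p / q - 1) = p - q := by field_simp
    linarith

lemma term_nonneg (p q : ℝ) (hp : 0 ≤ p) (hq : 0 ≤ q) (h : q = 0 → p = 0) :
    0 ≤ p * Real.log (p / q) - p + q := by
  rcases hp.eq_or_lt with hp | hp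
  · subst hp; simpa using hq
  · have hq' : 0 < q := lt_of_le_of_ne hq (fun hh => hp.ne' (h hh.symm))
    have := Real.log_le_sub_one_of_pos (x := q / p) (by positivity)
    rw [← inv_div, Real.log_inv] at this
    have h2 := mul_le_mul_of_nonneg_left this hp.le
    have h3 : p * ((p / q)⁻¹ - 1) = q - p := by field_simp
    linarith

end det

section loc

lemma good_local
    (η : Z → ℝ) (π : Z → Z → ℝ) (ηn : ℕ → Z → ℝ) (πn : ℕ → Z → Z → ℝ)
    (hach : ∀ n : ℕ, ∃ z : TypedGraph n Z, typeMeasure z = ηn n ∧ linkMeasure z = πn n)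
    (hηpos : ∀ a, 0 < η a) (hηsum : ∑ a : Z, η a = 1) (hπnonneg : ∀ a b, 0 ≤ π a b)
    (hηconv : ∀ a, Tendsto (fun n => ηn n a) atTop (nhds (η a)))
    (hπconv : ∀ a b, Tendsto (fun n => πn n a b) atTop (nhds (π a b)))
    (α : ℝ) (p : Z × (Z →₀ ℕ) → ℝ) (hp : ∀ x, 0 ≤ p x)
    (hα : (α : EReal) < (rateJ η π p : EReal)) :
    ∃ U ∈ nhds p, Good ηn πn α U := by
  by_cases hsub : SubConsistent π p
  swap
  · unfold SubConsistent at hsub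
    push Not at hsub
    obtain ⟨a, b, hab⟩ := hsub
    rw [ENNReal.tsum_eq_iSup_sum, lt_iSup_iff] at hab
    obtain ⟨S, hS⟩ := hab
    rw [← ENNReal.ofReal_sum_of_nonneg (fun e _ => mul_nonneg (hp _) (Nat.cast_nonneg _))] at hS
    have hS' := lt_of_not_ge fun hh => not_lt.2 (ENNReal.ofReal_le_ofReal hh) hS
    obtain ⟨m, hm1, hm2⟩ := exists_between hS'
    refine ⟨{p' | m < ∑ e ∈ S, p' (a, e) * (e b : ℝ)}, ?_, good_det _ _ _ _ ?_⟩
    · refine IsOpen.mem_nhds (isOpen_lt continuous_const ?_) hm2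
      fun_prop
    · filter_upwards [(hπconv a b).eventually_lt_const hm1] with n hn z hz hU
      have hz' := (Finset.mem_filter.1 hz).2
      have h1 := loc_link z a b S
      rw [hz'.2] at h1
      have hU' : m < ∑ e ∈ S, localityMeasure z (a, e) * (e b : ℝ) := hU
      linarith
  by_cases hmar : ∀ a : Z, HasSum (fun e : Z →₀ ℕ => p (a, e)) (η a)
  swap
  · push Not at hmar
    obtain ⟨a, ha⟩ := hmar
    by_cases hS : ∃ S : Finset (Z →₀ ℕ), η a < ∑ e ∈ S, p (a, e)
    · obtain ⟨S, hS⟩ := hS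
      obtain ⟨m, hm1, hm2⟩ := exists_between hS
      refine ⟨{p' | m < ∑ e ∈ S, p' (a, e)}, ?_, good_det _ _ _ _ ?_⟩
      · refine IsOpen.mem_nhds (isOpen_lt continuous_const ?_) hm2
        fun_prop
      · filter_upwards [(hηconv a).eventually_lt_const hm1] with n hn z hz hU
        have hz' := (Finset.mem_filter.1 hz).2
        have h1 := loc_type z a S
        rw [hz'.1] at h1
        have hU' : m < ∑ e ∈ S, localityMeasure z (a, e) := hU
        linarith
    · push Not at hS
      have hsm : Summable (fun e : Z →₀ ℕ => p (a, e)) := summable_of_sum_le (fun _ => hp _) hS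
      have hle : ∑' e : Z →₀ ℕ, p (a, e) ≤ η a := hsm.tsum_le_of_sum_le hS
      have hlt : ∑' e : Z →₀ ℕ, p (a, e) < η a := lt_of_le_of_ne hle (fun h => ha (h ▸ hsm.hasSum))
      obtain ⟨m, hm1, hm2⟩ := exists_between hlt
      have hT : 0 ≤ ∑ b, π a b := Finset.sum_nonneg fun b _ => hπnonneg a b
      obtain ⟨R, hR⟩ := exists_nat_gt ((∑ b, π a b) / (η a - m))
      have hR' : m + ∑ b, π a b / ((R:ℝ) + 1) < η a := by
        rw [← Finset.sum_div]
        rw [div_lt_iff₀ (by linarith)] at hR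
        have : (∑ b, π a b) / ((R:ℝ) + 1) < η a - m := by
          rw [div_lt_iff₀ (by positivity)]
          nlinarith
        linarith
      refine ⟨{p' | ∑ e ∈ SR Z R, p' (a, e) < m}, ?_, good_det _ _ _ _ ?_⟩
      · refine IsOpen.mem_nhds (isOpen_lt ?_ continuous_const)
          ((hsm.sum_le_tsum _ (fun _ _ => hp _)).trans_lt hm1)
        fun_prop
      · have t : Tendsto (fun n => m + ∑ b, πn n a b / ((R:ℝ) + 1)) atTop
            (nhds (m + ∑ b, π a b / ((R:ℝ) + 1))) :=
          tendsto_const_nhds.add (tendsto_finsetSum _ fun b _ => (hπconv a b).div_const _)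
        filter_upwards [t.eventually_lt (hηconv a) hR'] with n hn z hz hU
        have hz' := (Finset.mem_filter.1 hz).2
        have h1 := loc_tight z a R
        rw [hz'.1, hz'.2] at h1
        have hU' : ∑ e ∈ SR Z R, localityMeasure z (a, e) < m := hU
        linarith
  have hpmf : IsPMF p := by
    refine ⟨hp, ?_⟩
    have hs : Summable p := by
      rw [summable_prod_of_nonneg hp]
      exact ⟨fun a => (hmar a).summable, (hasSum_fintype _).summable⟩
    have h1 := hs.hasSum.prod_fiberwise hmar
    have h2 := h1.unique (hasSum_fintype η)
    rw [hηsum] at h2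
    rw [← h2]; exact hs.hasSum
  rw [rateJ, if_pos ⟨hpmf, hsub, hmar⟩, relEntropy] at hα
  have hq := q_nonneg η π hηpos hπnonneg
  by_cases hac : ∀ x, qMeasure η π x = 0 → p x = 0
  swap
  · push Not at hac
    obtain ⟨x, hx1, hx2⟩ := hac
    refine good_exp η π ηn πn hach hηpos hπnonneg hηconv hπconv {x} (fun _ => (α + 1) / p x) α p ?_
    rw [Finset.sum_singleton, hx1, mul_div_cancel₀ _ hx2]
    linarith
  rw [if_pos hac] at hα
  have hF : ∃ F : Finset (Z × (Z →₀ ℕ)), α <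
      ∑ x ∈ F, (p x * Real.log (p x / qMeasure η π x) - p x + qMeasure η π x) := by
    rcases lt_or_ge α 0 with h0 | h0
    · exact ⟨∅, by simpa using h0⟩
    have hα' : ENNReal.ofReal α < ∑' x, ENNReal.ofReal
        (p x * Real.log (p x / qMeasure η π x) - p x + qMeasure η π x) := by
      rw [← EReal.coe_ennreal_lt_coe_ennreal_iff, EReal.coe_ennreal_ofReal, max_eq_left h0]
      exact hα
    rw [ENNReal.tsum_eq_iSup_sum, lt_iSup_iff] at hα'
    obtain ⟨F, hF⟩ := hα'
    rw [← ENNReal.ofReal_sum_of_nonneg (fun x _ => term_nonneg _ _ (hp x) (hq x) (hac x))] at hF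
    exact ⟨F, lt_of_not_ge fun hh => not_lt.2 (ENNReal.ofReal_le_ofReal hh) hF⟩
  obtain ⟨F, hF⟩ := hF
  set d := ∑ x ∈ F, (p x * Real.log (p x / qMeasure η π x) - p x + qMeasure η π x) - α with hd
  have hd0 : 0 < d := by linarith
  have hε : 0 < d / ((F.card : ℝ) + 1) := by positivity
  choose f hf using fun x => term_approx (p x) (qMeasure η π x) (hp x) (hq x) (hac x) _ hε
  refine good_exp η π ηn πn hach hηpos hπnonneg hηconv hπconv F f α p ?_
  have h1 := Finset.sum_le_sum (s := F) (fun x _ => (hf x).le)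
  rw [Finset.sum_sub_distrib, Finset.sum_const, nsmul_eq_mul] at h1
  have h2 : (F.card : ℝ) * (d / ((F.card : ℝ) + 1)) < d := by
    rw [mul_div_assoc', div_lt_iff₀ (by positivity)]
    nlinarith
  linarith

lemma good_all
    (ηn : ℕ → Z → ℝ) (πn : ℕ → Z → Z → ℝ) (Γ : Set ((Z × (Z →₀ ℕ)) → ℝ)) (hΓ : IsClosed Γ) (α : ℝ)
    (hloc : ∀ p ∈ Γ, (∀ x, 0 ≤ p x) → ∃ U ∈ nhds p, Good ηn πn α U) :
    Good ηn πn α Γ := by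
  have hmono : ∀ s t : Set ((Z × (Z →₀ ℕ)) → ℝ), s ⊆ t → Good ηn πn α t → Good ηn πn α s := by
    rintro s t hst ⟨C, hC, h⟩
    refine ⟨C, hC, ?_⟩
    filter_upwards [h] with n hn
    refine le_trans ?_ hn
    have : ((TT n (ηn n) (πn n)).filter (fun z => localityMeasure z ∈ s)).card ≤
      ((TT n (ηn n) (πn n)).filter (fun z => localityMeasure z ∈ t)).card :=
      Finset.card_le_card (Finset.monotone_filter_right _ (fun z _ hz => hst hz))
    exact_mod_cast this
  have hunion : ∀ s t : Set ((Z × (Z →₀ ℕ)) → ℝ), Good ηn πn α s → Good ηn πn α t →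
      Good ηn πn α (s ∪ t) := by
    rintro s t ⟨C, hC, h⟩ ⟨C', hC', h'⟩
    refine ⟨C + C', by positivity, ?_⟩
    filter_upwards [h, h'] with n hn hn'
    have h1 : ((TT n (ηn n) (πn n)).filter (fun z => localityMeasure z ∈ s ∪ t)).card ≤
      ((TT n (ηn n) (πn n)).filter (fun z => localityMeasure z ∈ s)).card +
      ((TT n (ηn n) (πn n)).filter (fun z => localityMeasure z ∈ t)).card := by
      refine le_trans (Finset.card_le_card ?_) (Finset.card_union_le _ _)
      intro z hz
      simp only [Finset.mem_filter, Finset.mem_union, Set.mem_union] at hz ⊢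
      tauto
    have h2 : (((TT n (ηn n) (πn n)).filter (fun z => localityMeasure z ∈ s ∪ t)).card : ℝ) ≤
      ((TT n (ηn n) (πn n)).filter (fun z => localityMeasure z ∈ s)).card +
      ((TT n (ηn n) (πn n)).filter (fun z => localityMeasure z ∈ t)).card := by exact_mod_cast h1
    rw [add_mul, mul_add]
    have h3 := h2.trans (add_le_add hn hn')
    refine le_trans (le_of_eq ?_) h3
    congr!
  set K : Set ((Z × (Z →₀ ℕ)) → ℝ) := Γ ∩ Set.univ.pi (fun _ => Set.Icc (0:ℝ) 1) with hK
  have hKc : IsCompact K := (isCompact_univ_pi (fun _ => isCompact_Icc)).inter_left hΓ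
  have hKG : Good ηn πn α K := by
    refine hKc.induction_on (p := fun s => Good ηn πn α s) ?_ hmono hunion ?_
    · exact good_det _ _ _ _ (Eventually.of_forall fun n z _ h => h)
    · intro p hp
      obtain ⟨U, hU, hg⟩ := hloc p hp.1 (fun x => (hp.2 x (Set.mem_univ x)).1)
      exact ⟨U, mem_nhdsWithin_of_mem_nhds hU, hg⟩
  obtain ⟨C, hC, h⟩ := hKG
  refine ⟨C, hC, ?_⟩
  filter_upwards [h] with n hn
  have : (TT n (ηn n) (πn n)).filter (fun z => localityMeasure z ∈ Γ) =
      (TT n (ηn n) (πn n)).filter (fun z => localityMeasure z ∈ K) := by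
    refine Finset.filter_congr fun z _ => ?_
    refine ⟨fun h => ⟨h, fun x _ => ⟨loc_nonneg z x, loc_le_one z x⟩⟩, fun h => h.1⟩
  rw [this]
  convert hn

lemma limsup_good (ηn : ℕ → Z → ℝ) (πn : ℕ → Z → Z → ℝ) (Γ : Set ((Z × (Z →₀ ℕ)) → ℝ)) (α β : ℝ)
    (hαβ : α < β) (h : Good ηn πn β Γ) :
    limsup (fun n : ℕ => ((n : ℝ)⁻¹ : EReal) *
        ENNReal.log (condProb n (ηn n) (πn n) {z | localityMeasure z ∈ Γ})) atTop ≤ ((-α : ℝ) : EReal) := by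
  obtain ⟨C, hC, h⟩ := h
  refine limsup_le_of_le (by isBoundedDefault) ?_
  obtain ⟨N, hN⟩ := exists_nat_gt (Real.log (C + 1) / (β - α))
  filter_upwards [h, eventually_ge_atTop N, eventually_gt_atTop 0] with n hn hnN hn0
  have hn0' : (0:ℝ) < n := by exact_mod_cast hn0
  have h1 : C * Real.exp (-(n * β)) ≤ Real.exp (-(n * α)) := by
    have hnN' : (N:ℝ) ≤ n := by exact_mod_cast hnN
    rw [div_lt_iff₀ (by linarith)] at hN
    have h2 : Real.log (C + 1) ≤ n * (β - α) := by nlinarith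
    have h3 : C ≤ Real.exp (n * (β - α)) := by
      calc C ≤ C + 1 := by linarith
        _ = Real.exp (Real.log (C + 1)) := (Real.exp_log (by linarith)).symm
        _ ≤ _ := Real.exp_le_exp.2 h2
    calc _ ≤ Real.exp (n * (β - α)) * Real.exp (-(n * β)) :=
          mul_le_mul_of_nonneg_right h3 (Real.exp_pos _).le
      _ = _ := by rw [← Real.exp_add]; congr 1; ring
  have h2 := condProb_le n (ηn n) (πn n) {z | localityMeasure z ∈ Γ} (Real.exp (-(n * α))) (Real.exp_pos _).le
    (hn.trans (mul_le_mul_of_nonneg_left h1 (Nat.cast_nonneg _)))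
  have h3 : ENNReal.log (condProb n (ηn n) (πn n) {z | localityMeasure z ∈ Γ}) ≤ ((-(n * α) : ℝ) : EReal) := by
    refine (ENNReal.log_monotone h2).trans (le_of_eq ?_)
    rw [ENNReal.log_ofReal_of_pos (Real.exp_pos _), Real.log_exp]
  have e1 : ((n : ℝ)⁻¹ : EReal) = (((n : ℝ)⁻¹ : ℝ) : EReal) := (EReal.coe_inv _).symm
  rw [e1]
  calc _ ≤ (((n : ℝ)⁻¹ : ℝ) : EReal) * ((-(n * α) : ℝ) : EReal) :=
        mul_le_mul_of_nonneg_left h3 (by exact_mod_cast (by positivity : (0:ℝ) ≤ (n:ℝ)⁻¹))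
    _ = _ := by
        rw [← EReal.coe_mul]
        congr 1
        field_simp

end loc

/-- **Full large deviation upper bound** for the empirical locality measure of a
typed random graph conditioned on its empirical type and link measures: for every
weakly (= pointwise) closed set `Γ` of measures,
`limsup (1/n) log Q_{(ηn,πn)}{P_z ∈ Γ} ≤ -inf_{p ∈ Γ} J_{(η,π)}(p)`. -/
theorem ldp_upper_bound
    (η : Z → ℝ) (π : Z → Z → ℝ) (ηn : ℕ → Z → ℝ) (πn : ℕ → Z → Z → ℝ)
    (hach : ∀ n : ℕ, ∃ z : TypedGraph n Z, typeMeasure z = ηn n ∧ linkMeasure z = πn n)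
    (hηpos : ∀ a, 0 < η a) (hηsum : ∑ a : Z, η a = 1)
    (hπsymm : ∀ a b, π a b = π b a) (hπnonneg : ∀ a b, 0 ≤ π a b)
    (hηconv : ∀ a, Tendsto (fun n => ηn n a) atTop (nhds (η a)))
    (hπconv : ∀ a b, Tendsto (fun n => πn n a b) atTop (nhds (π a b)))
    (Γ : Set ((Z × (Z →₀ ℕ)) → ℝ)) (hΓ : IsClosed Γ) :
    limsup (fun n : ℕ => ((n : ℝ)⁻¹ : EReal) *
        ENNReal.log (condProb n (ηn n) (πn n) {z | localityMeasure z ∈ Γ})) atTop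
      ≤ -(⨅ p ∈ Γ, (rateJ η π p : EReal)) := by
  by_contra hcon
  rw [not_le] at hcon
  obtain ⟨r, hr1, hr2⟩ := EReal.lt_iff_exists_real_btwn.1 hcon
  obtain ⟨r', hr1', hr2'⟩ := EReal.lt_iff_exists_real_btwn.1 hr1
  have hrr : -r < -r' := neg_lt_neg (by exact_mod_cast hr2')
  have hg : Good ηn πn (-r') Γ := by
    refine good_all ηn πn Γ hΓ (-r') fun p hp hp0 => ?_
    refine good_local η π ηn πn hach hηpos hηsum hπnonneg hηconv hπconv (-r') p hp0 ?_
    rw [EReal.coe_neg]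
    exact (EReal.neg_lt_comm.1 hr1').trans_le (iInf₂_le p hp)
  have := limsup_good ηn πn Γ (-r) (-r') hrr hg
  rw [neg_neg] at this
  exact absurd hr2 (not_lt.2 this)
end

section
/- Large deviation upper bound for the degree distribution of the classical Erdős–Rényi graph with a fixed number of edges: Fix c > 0 and for each n let G(n, ⌊nc/2⌋) denote the uniform distribution on the set of simple graphs on n vertices with exactly ⌊nc/2⌋ edges. Then for every closed subset Γ of the space of probability measures on ℕ (weak topology), limsup_{n→∞} (1/n) · log G(n, ⌊nc/2⌋){ z : D_z ∈ Γ } ≤ − inf_{p ∈ Γ} I_c(p). -/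
open Filter
open scoped ENNReal BigOperators Classical

/-- The degree distribution `D_z` of a simple graph `z` on `n` vertices:
`D_z(k) = (1/n) · #{vertices i with degree k}`. -/
noncomputable def degreeDist {n : ℕ} (z : SimpleGraph (Fin n)) (k : ℕ) : ℝ :=
  (Nat.card {i : Fin n // Nat.card {j : Fin n // z.Adj i j} = k} : ℝ) / n

/-- `erProb n m A` is the probability of the event `A` under the uniform
distribution `G(n, m)` on the set of simple graphs on `n` vertices with
exactly `m` edges. -/
noncomputable def erProb (n m : ℕ) (A : Set (SimpleGraph (Fin n))) : ℝ≥0∞ :=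
  (Nat.card {z : SimpleGraph (Fin n) // Nat.card z.edgeSet = m ∧ z ∈ A} : ℝ≥0∞) /
  (Nat.card {z : SimpleGraph (Fin n) // Nat.card z.edgeSet = m} : ℝ≥0∞)

/-- The Poisson distribution on `ℕ` with mean `c`: `q_c(k) = e^{-c} c^k / k!`. -/
noncomputable def poissonPMF (c : ℝ) (k : ℕ) : ℝ :=
  Real.exp (-c) * c ^ k / (k.factorial : ℝ)

/-- The rate function `I_c(p) = H(p ∥ q_c)` if `p` is a probability measure on `ℕ`
with mean `c`, and `∞` otherwise. -/
noncomputable def rateI (c : ℝ) (p : ℕ → ℝ) : ℝ≥0∞ :=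
  if IsPMF p ∧ HasSum (fun k : ℕ => (k : ℝ) * p k) c then
    relEntropy p (poissonPMF c)
  else ∞


lemma seq_sum {J : Type} [Fintype J] [DecidableEq J] (n : ℕ) (w : ℕ → ℝ) :
    ∑ t : J → Fin n, ∏ i, w (Nat.card {j : J // t j = i}) =
      ∑ d ∈ Finset.piAntidiag (Finset.univ : Finset (Fin n)) (Fintype.card J),
        (Nat.multinomial Finset.univ d : ℝ) * ∏ i, w (d i) := by
  have key : ∑ t : J → Fin n, MvPolynomial.monomial
        (Finsupp.equivFunOnFinite.symm (fun i => Nat.card {j : J // t j = i})) (1 : ℝ) =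
      ∑ d ∈ Finset.piAntidiag (Finset.univ : Finset (Fin n)) (Fintype.card J),
        (Nat.multinomial Finset.univ d : ℝ) •
          MvPolynomial.monomial (Finsupp.equivFunOnFinite.symm d) (1 : ℝ) := by
    have h1 := Finset.sum_pow_eq_sum_piAntidiag (Finset.univ : Finset (Fin n))
      (fun i => (MvPolynomial.X i : MvPolynomial (Fin n) ℝ)) (Fintype.card J)
    have h2 : (∑ i : Fin n, (MvPolynomial.X i : MvPolynomial (Fin n) ℝ)) ^ (Fintype.card J) =
        ∑ t : J → Fin n, ∏ j, MvPolynomial.X (t j) := by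
      have := Finset.prod_univ_sum (fun _ : J => (Finset.univ : Finset (Fin n)))
        (fun _ i => (MvPolynomial.X i : MvPolynomial (Fin n) ℝ))
      rw [Fintype.piFinset_univ] at this
      rw [← this]; simp
    have h3 : ∀ d : Fin n → ℕ, MvPolynomial.monomial (Finsupp.equivFunOnFinite.symm d) (1 : ℝ)
        = ∏ i, (MvPolynomial.X i : MvPolynomial (Fin n) ℝ) ^ d i := by
      intro d
      rw [MvPolynomial.monomial_eq]
      simp [Finsupp.prod_fintype]
    simp only [h3]
    rw [h2] at h1
    rw [show (∑ t : J → Fin n, ∏ i, (MvPolynomial.X i : MvPolynomial (Fin n) ℝ) ^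
      (Nat.card {j : J // t j = i})) = ∑ t : J → Fin n, ∏ j, MvPolynomial.X (t j) from ?_, h1]
    · refine Finset.sum_congr rfl fun d _ => ?_
      rw [MvPolynomial.smul_eq_C_mul]; simp
    · refine Finset.sum_congr rfl fun t _ => ?_
      rw [← Finset.prod_fiberwise (Finset.univ : Finset J) t]
      refine Finset.prod_congr rfl fun i _ => ?_
      rw [Finset.prod_congr rfl (g := fun _ => MvPolynomial.X i)]
      · rw [Finset.prod_const, Nat.card_eq_fintype_card, Fintype.card_subtype]
      · intro j hj; simp at hj; rw [hj]
  have := congrArg ((MvPolynomial.basisMonomials (Fin n) ℝ).constr ℝ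
    (fun d => ∏ i, w (d i))) key
  rw [map_sum, map_sum] at this
  have h4 : ∀ d, ((MvPolynomial.basisMonomials (Fin n) ℝ).constr ℝ
    (fun d => ∏ i, w (d i))) (MvPolynomial.monomial d 1) = ∏ i, w (d i) := by
    intro d
    have := Module.Basis.constr_basis (MvPolynomial.basisMonomials (Fin n) ℝ) ℝ (fun d => ∏ i, w (d i)) d
    rwa [MvPolynomial.coe_basisMonomials] at this
  simp only [map_smul, h4] at this
  simpa using this

lemma seq_bound {J : Type} [Fintype J] [DecidableEq J] (n : ℕ) (w : ℕ → ℝ) (hw : ∀ k, 0 ≤ w k) (c : ℝ) (hc : 0 < c)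
    (Z : ℝ) (hZ : HasSum (fun k => poissonPMF c k * w k) Z) :
    ∑ t : J → Fin n, ∏ i, w (Nat.card {j : J // t j = i}) ≤
      ((Fintype.card J).factorial : ℝ) / c ^ (Fintype.card J) * (Real.exp c * Z) ^ n := by
  rw [seq_sum]
  set N := Fintype.card J
  have hsum : ∀ d ∈ Finset.piAntidiag (Finset.univ : Finset (Fin n)) N,
      (Nat.multinomial Finset.univ d : ℝ) * ∏ i, w (d i) =
       (N.factorial : ℝ) / c ^ N * ∏ i, (w (d i) * c ^ (d i) / ((d i).factorial : ℝ)) := by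
    intro d hd
    have hd' : ∑ i, d i = N := by simpa using hd
    have h1 : (∏ i, ((d i).factorial : ℝ)) * (Nat.multinomial Finset.univ d : ℝ) = N.factorial := by
      rw [← hd']; exact_mod_cast Nat.multinomial_spec Finset.univ d
    have h2 : (∏ i, ((d i).factorial : ℝ)) ≠ 0 :=
      Finset.prod_ne_zero_iff.2 fun i _ => by positivity
    rw [Finset.prod_div_distrib, Finset.prod_mul_distrib, Finset.prod_pow_eq_pow_sum, hd', ← h1]
    field_simp
  rw [Finset.sum_congr rfl hsum, ← Finset.mul_sum]
  refine mul_le_mul_of_nonneg_left ?_ (by positivity)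
  have hnn : ∀ k, 0 ≤ w k * c ^ k / (k.factorial : ℝ) := fun k => by have := hw k; positivity
  calc _ ≤ ∑ d ∈ Fintype.piFinset (fun _ : Fin n => Finset.range (N + 1)),
        ∏ i, (w (d i) * c ^ (d i) / ((d i).factorial : ℝ)) := by
        refine Finset.sum_le_sum_of_subset_of_nonneg ?_ fun d _ _ =>
          Finset.prod_nonneg fun i _ => hnn _
        intro d hd
        have hd' : ∑ i, d i = N := by simpa using hd
        simp only [Fintype.mem_piFinset, Finset.mem_range]
        intro i
        have := Finset.single_le_sum (f := d) (fun _ _ => Nat.zero_le _) (Finset.mem_univ i)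
        omega
    _ = (∑ k ∈ Finset.range (N + 1), w k * c ^ k / (k.factorial : ℝ)) ^ n := by
        have := (Finset.prod_univ_sum (fun _ : Fin n => Finset.range (N + 1))
          (fun _ k => w k * c ^ k / (k.factorial : ℝ)))
        rw [← this]; simp
    _ ≤ _ := by
        refine pow_le_pow_left₀ (Finset.sum_nonneg fun k _ => hnn k) ?_ n
        have h3 : HasSum (fun k => w k * c ^ k / (k.factorial : ℝ)) (Real.exp c * Z) := by
          have h4 := hZ.mul_left (Real.exp c)
          have h5 : (fun k => w k * c ^ k / (k.factorial : ℝ)) =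
              fun k => Real.exp c * (poissonPMF c k * w k) := by
            funext k
            unfold poissonPMF
            rw [Real.exp_neg]; field_simp
          rw [h5]; exact h4
        exact sum_le_hasSum _ (fun k _ => hnn k) h3

noncomputable def gdeg {n : ℕ} (z : SimpleGraph (Fin n)) (i : Fin n) : ℕ :=
  Nat.card {j : Fin n // z.Adj i j}

noncomputable def phiMap {n m : ℕ} (z : SimpleGraph (Fin n)) (σ : Fin m ≃ z.edgeSet)
    (b : Fin m → Bool) (x : Fin m × Bool) : Fin n :=
  if (xor (b x.1) x.2) then (Quot.out (σ x.1).1).1 else (Quot.out (σ x.1).1).2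

lemma phiMap_edge {n m : ℕ} (z : SimpleGraph (Fin n)) (σ : Fin m ≃ z.edgeSet)
    (b : Fin m → Bool) (k : Fin m) (y : Bool) :
    s(phiMap z σ b (k, y), phiMap z σ b (k, !y)) = (σ k).1 := by
  have h : s((Quot.out (σ k).1).1, (Quot.out (σ k).1).2) = (σ k).1 := Quot.out_eq _
  unfold phiMap
  cases b k <;> cases y <;> simp [h] <;> rw [Sym2.eq_swap, h]

lemma phiMap_adj {n m : ℕ} (z : SimpleGraph (Fin n)) (σ : Fin m ≃ z.edgeSet)
    (b : Fin m → Bool) (k : Fin m) (y : Bool) :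
    z.Adj (phiMap z σ b (k, y)) (phiMap z σ b (k, !y)) := by
  rw [← SimpleGraph.mem_edgeSet, phiMap_edge]
  exact (σ k).2

lemma phiMap_card {n m : ℕ} (z : SimpleGraph (Fin n)) (σ : Fin m ≃ z.edgeSet)
    (b : Fin m → Bool) (i : Fin n) :
    Nat.card {x : Fin m × Bool // phiMap z σ b x = i} = gdeg z i := by
  refine Nat.card_congr (Equiv.ofBijective
    (fun x => ⟨phiMap z σ b (x.1.1, !x.1.2), ?_⟩) ⟨?_, ?_⟩)
  · have := phiMap_adj z σ b x.1.1 x.1.2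
    rwa [Prod.mk.eta, x.2] at this
  · rintro ⟨⟨k, y⟩, h⟩ ⟨⟨k', y'⟩, h'⟩ heq
    simp only [Subtype.mk.injEq] at heq
    have e1 := phiMap_edge z σ b k y
    rw [h, heq, ← h', phiMap_edge] at e1
    have hk : k' = k := σ.injective (Subtype.ext e1)
    subst hk
    have : y = y' := by
      by_contra hne
      have hy : y' = !y := by cases y <;> cases y' <;> simp_all
      have := (phiMap_adj z σ b k' y).ne
      rw [← hy, h, h'] at this
      exact this rfl
    subst this; rfl
  · rintro ⟨j, hj⟩
    set k := σ.symm ⟨s(i, j), hj⟩ with hk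
    have hσ : (σ k).1 = s(i, j) := by simp [hk]
    have e := phiMap_edge z σ b k false
    rw [hσ, Sym2.eq_iff] at e
    rcases e with ⟨h1, h2⟩ | ⟨h1, h2⟩
    · exact ⟨⟨(k, false), h1⟩, Subtype.ext h2⟩
    · exact ⟨⟨(k, true), h2⟩, Subtype.ext h1⟩

lemma phiMap_inj {n m : ℕ} (z z' : SimpleGraph (Fin n)) (σ : Fin m ≃ z.edgeSet)
    (σ' : Fin m ≃ z'.edgeSet) (b b' : Fin m → Bool) (h : phiMap z σ b = phiMap z' σ' b') :
    z = z' ∧ HEq σ σ' ∧ b = b' := by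
  have hσ : ∀ k, (σ k).1 = (σ' k).1 := fun k => by
    rw [← phiMap_edge z σ b k false, ← phiMap_edge z' σ' b' k false, h]
  have hz : z = z' := by
    rw [← SimpleGraph.edgeSet_inj]
    ext e
    constructor
    · intro he
      have := hσ (σ.symm ⟨e, he⟩)
      simp only [Equiv.apply_symm_apply] at this
      rw [this]; exact (σ' _).2
    · intro he
      have := hσ (σ'.symm ⟨e, he⟩)
      simp only [Equiv.apply_symm_apply] at this
      rw [← this]; exact (σ _).2
  subst hz
  have hs : σ = σ' := Equiv.ext fun k => Subtype.ext (hσ k)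
  subst hs
  refine ⟨rfl, HEq.rfl, ?_⟩
  funext k
  by_contra hne
  have hb : b' k = !b k := by cases hb : b k <;> cases hb' : b' k <;> simp_all
  have h1 : phiMap z σ b' (k, false) = phiMap z σ b (k, true) := by
    unfold phiMap; simp [hb]
  have h2 := phiMap_adj z σ b k false
  rw [h, h1, ← h] at h2
  exact h2.ne rfl

lemma graph_sum_le (n m : ℕ) (w : ℕ → ℝ) (hw : ∀ k, 0 ≤ w k) :
    (2 : ℝ) ^ m * m.factorial *
      ∑ z : {z : SimpleGraph (Fin n) // Nat.card z.edgeSet = m}, ∏ i, w (gdeg z.1 i) ≤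
    ∑ t : Fin m × Bool → Fin n, ∏ i, w (Nat.card {j : Fin m × Bool // t j = i}) := by
  let X := Σ z : {z : SimpleGraph (Fin n) // Nat.card z.edgeSet = m},
    (Fin m ≃ z.1.edgeSet) × (Fin m → Bool)
  let Φ : X → (Fin m × Bool → Fin n) := fun x => phiMap x.1.1 x.2.1 x.2.2
  have hΦ : Function.Injective Φ := by
    rintro ⟨⟨z, hz⟩, σ, b⟩ ⟨⟨z', hz'⟩, σ', b'⟩ h
    obtain ⟨h1, h2, h3⟩ := phiMap_inj z z' σ σ' b b' h
    subst h1; subst h3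
    cases h2
    rfl
  let _ : Fintype X := inferInstanceAs (Fintype (Σ z : {z : SimpleGraph (Fin n) // Nat.card z.edgeSet = m},
    (Fin m ≃ z.1.edgeSet) × (Fin m → Bool)))
  calc _ = ∑ x : X, ∏ i, w (gdeg x.1.1 i) := by
        refine Eq.trans ?_ (Fintype.sum_sigma (fun x : X => ∏ i, w (gdeg x.1.1 i))).symm
        rw [Finset.mul_sum]
        refine Finset.sum_congr rfl fun z _ => ?_
        dsimp only
        rw [Finset.sum_const, nsmul_eq_mul]
        congr 1
        have e : Fin m ≃ z.1.edgeSet := by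
          refine (Finite.equivFinOfCardEq z.2).symm
        rw [Finset.card_univ, Fintype.card_prod, Fintype.card_equiv e]
        simp [mul_comm]
    _ = ∑ x : X, ∏ i, w (Nat.card {j : Fin m × Bool // Φ x j = i}) := by
        refine Finset.sum_congr rfl fun x _ => Finset.prod_congr rfl fun i _ => ?_
        rw [phiMap_card]
    _ = ∑ t ∈ Finset.univ.map ⟨Φ, hΦ⟩, ∏ i, w (Nat.card {j : Fin m × Bool // t j = i}) := by
        rw [Finset.sum_map]; rfl
    _ ≤ _ := Finset.sum_le_univ_sum_of_nonneg fun t => Finset.prod_nonneg fun i _ => hw _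

lemma card_graphs_ge (n m : ℕ) :
    (n.choose 2).choose m ≤ Nat.card {z : SimpleGraph (Fin n) // Nat.card z.edgeSet = m} := by
  have h1 : (n.choose 2).choose m =
      Nat.card {s : Finset (Sym2 (Fin n)) // s ∈ Finset.powersetCard m (⊤ : SimpleGraph (Fin n)).edgeFinset} := by
    rw [Nat.card_eq_fintype_card, Fintype.card_coe, Finset.card_powersetCard,
      SimpleGraph.card_edgeFinset_top_eq_card_choose_two, Fintype.card_fin]
  rw [h1]
  have hE : ∀ s : Finset (Sym2 (Fin n)), s ∈ Finset.powersetCard m (⊤ : SimpleGraph (Fin n)).edgeFinset →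
      (SimpleGraph.fromEdgeSet (s : Set (Sym2 (Fin n)))).edgeSet = s := by
    intro s hs
    rw [Finset.mem_powersetCard] at hs
    rw [SimpleGraph.edgeSet_fromEdgeSet]
    ext e
    simp only [Set.mem_sdiff, Finset.mem_coe, and_iff_left_iff_imp]
    intro he
    have := hs.1 he
    simpa using this
  refine Nat.card_le_card_of_injective
    (fun s => ⟨SimpleGraph.fromEdgeSet (s.1 : Set (Sym2 (Fin n))), ?_⟩) ?_
  · rw [hE s.1 s.2]
    simp [(Finset.mem_powersetCard.1 s.2).2]
  · rintro ⟨s, hs⟩ ⟨t, ht⟩ h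
    simp only [Subtype.mk.injEq] at h
    have := congrArg SimpleGraph.edgeSet h
    rw [hE s hs, hE t ht] at this
    have this' : s = t := by exact_mod_cast this
    exact Subtype.ext this'

lemma factorial_bound (N : ℕ) : (N.factorial : ℝ) * Real.exp N ≤ Real.exp 1 * (N + 1) * (N : ℝ) ^ N := by
  have h : ∀ N : ℕ, 1 ≤ N →
      (N.factorial : ℝ) * Real.exp N ≤ Real.exp 1 * N * (N : ℝ) ^ N := by
    intro N hN
    induction N, hN using Nat.le_induction with
    | base => simp
    | succ N hN ih =>
      have h1 : Real.exp 1 * (N : ℝ) ^ (N + 1) ≤ ((N : ℝ) + 1) ^ (N + 1) := by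
        have h2 := Real.add_one_le_exp (-(1 / ((N : ℝ) + 1)))
        have h3 : (N : ℝ) ≤ (N + 1) * Real.exp (-(1 / ((N : ℝ) + 1))) := by
          have : (N : ℝ) = (N + 1) * (-(1 / ((N : ℝ) + 1)) + 1) := by field_simp; ring
          calc (N : ℝ) = (N + 1) * (-(1 / ((N : ℝ) + 1)) + 1) := this
            _ ≤ _ := by gcongr
        have h4 := pow_le_pow_left₀ (by positivity) h3 (N + 1)
        rw [mul_pow, ← Real.exp_nat_mul] at h4
        have h5 : ((N + 1 : ℕ) : ℝ) * -(1 / ((N : ℝ) + 1)) = -1 := by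
          push_cast; field_simp
        rw [h5] at h4
        calc _ ≤ Real.exp 1 * (((N : ℝ) + 1) ^ (N + 1) * Real.exp (-1)) := by gcongr
          _ = (Real.exp 1 * Real.exp (-1)) * ((N : ℝ) + 1) ^ (N + 1) := by ring
          _ = _ := by rw [← Real.exp_add]; simp
      rw [Nat.factorial_succ]
      push_cast
      rw [Real.exp_add]
      calc ((N : ℝ) + 1) * N.factorial * (Real.exp N * Real.exp 1)
          = ((N : ℝ) + 1) * Real.exp 1 * (N.factorial * Real.exp N) := by ring
        _ ≤ ((N : ℝ) + 1) * Real.exp 1 * (Real.exp 1 * N * (N : ℝ) ^ N) := by gcongr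
        _ = ((N : ℝ) + 1) * Real.exp 1 * (Real.exp 1 * (N : ℝ) ^ (N + 1)) := by ring
        _ ≤ ((N : ℝ) + 1) * Real.exp 1 * ((N : ℝ) + 1) ^ (N + 1) := by gcongr
        _ = _ := by ring
  rcases Nat.eq_zero_or_pos N with rfl | hN
  · simp
  · refine (h N hN).trans ?_
    gcongr
    linarith

lemma fact_exp_bound (N : ℕ) (x : ℝ) (h1 : (N : ℝ) ≤ x) (h2 : x ≤ N + 2) :
    (N.factorial : ℝ) * Real.exp x ≤ Real.exp 3 * (x + 1) * x ^ N := by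
  have hN : (0 : ℝ) ≤ N := Nat.cast_nonneg N
  calc (N.factorial : ℝ) * Real.exp x ≤ (N.factorial : ℝ) * Real.exp (N + 2) := by gcongr
    _ = (N.factorial * Real.exp N) * Real.exp 2 := by rw [Real.exp_add]; ring
    _ ≤ (Real.exp 1 * (N + 1) * (N : ℝ) ^ N) * Real.exp 2 :=
        mul_le_mul_of_nonneg_right (factorial_bound N) (Real.exp_pos _).le
    _ = Real.exp 3 * (N + 1) * (N : ℝ) ^ N := by
        rw [show (3 : ℝ) = 1 + 2 by norm_num, Real.exp_add]; ring
    _ ≤ _ := by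
        have : 0 ≤ x := hN.trans h1
        gcongr

lemma graphs_lower (n m : ℕ) (c : ℝ) (hc : 0 < c) (hn : 2 * (1 + c) ≤ n)
    (hm : 2 * (m : ℝ) ≤ n * c) :
    (n : ℝ) ^ (2 * m) ≤ Real.exp (c * (1 + c)) * ((2 : ℝ) ^ m * m.factorial *
      Nat.card {z : SimpleGraph (Fin n) // Nat.card z.edgeSet = m}) := by
  have hn0 : (0 : ℝ) < n := by linarith
  set x : ℝ := (1 + c) / n with hx
  have hx0 : 0 ≤ x := by positivity
  have hx2 : x ≤ 1 / 2 := by rw [hx, div_le_iff₀ hn0]; linarith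
  have h1 : 1 ≤ (1 - x) * Real.exp (2 * x) := by
    have := Real.add_one_le_exp (2 * x)
    nlinarith
  have h2 : 1 ≤ (1 - x) ^ m * Real.exp (c * (1 + c)) := by
    calc (1 : ℝ) ≤ ((1 - x) * Real.exp (2 * x)) ^ m := one_le_pow₀ h1
      _ = (1 - x) ^ m * Real.exp (m * (2 * x)) := by rw [mul_pow, ← Real.exp_nat_mul]
      _ ≤ _ := by
        have : (0 : ℝ) ≤ 1 - x := by linarith
        refine mul_le_mul_of_nonneg_left (Real.exp_le_exp.2 ?_) (by positivity)
        calc (m : ℝ) * (2 * x) = (2 * m) * x := by ring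
          _ ≤ (n * c) * x := by gcongr
          _ = c * (1 + c) := by rw [hx]; field_simp
  have h3 : (n : ℝ) ^ (2 * m) * (1 - x) ^ m ≤ (2 : ℝ) ^ m * m.factorial *
      Nat.card {z : SimpleGraph (Fin n) // Nat.card z.edgeSet = m} := by
    have a1 := card_graphs_ge n m
    have a2 := Nat.pow_sub_le_descFactorial (n.choose 2) m
    rw [Nat.descFactorial_eq_factorial_mul_choose] at a2
    have a3 : (n : ℝ) ^ 2 * (1 - x) ≤ 2 * ((n.choose 2 + 1 - m : ℕ) : ℝ) := by
      have b1 : ((n.choose 2 : ℕ) : ℝ) + 1 - m ≤ ((n.choose 2 + 1 - m : ℕ) : ℝ) := by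
        have : n.choose 2 + 1 ≤ (n.choose 2 + 1 - m) + m := by omega
        have : ((n.choose 2 + 1 : ℕ) : ℝ) ≤ ((n.choose 2 + 1 - m + m : ℕ) : ℝ) := by exact_mod_cast this
        push_cast at this
        linarith
      rw [Nat.cast_choose_two] at b1
      have b2 : (n : ℝ) ^ 2 * (1 - x) = n ^ 2 - n - n * c := by rw [hx]; field_simp; ring
      rw [b2]; nlinarith
    have a4 : (0 : ℝ) ≤ (n : ℝ) ^ 2 * (1 - x) := by
      have : (0 : ℝ) ≤ 1 - x := by linarith
      positivity
    calc (n : ℝ) ^ (2 * m) * (1 - x) ^ m = ((n : ℝ) ^ 2 * (1 - x)) ^ m := by rw [mul_pow, pow_mul]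
      _ ≤ (2 * ((n.choose 2 + 1 - m : ℕ) : ℝ)) ^ m := pow_le_pow_left₀ a4 a3 m
      _ = 2 ^ m * (((n.choose 2 + 1 - m) ^ m : ℕ) : ℝ) := by rw [mul_pow]; push_cast; rfl
      _ ≤ 2 ^ m * ((m.factorial * (n.choose 2).choose m : ℕ) : ℝ) := by gcongr
      _ ≤ 2 ^ m * ((m.factorial * Nat.card {z : SimpleGraph (Fin n) // Nat.card z.edgeSet = m} : ℕ) : ℝ) := by
          gcongr
      _ = _ := by push_cast; ring
  calc (n : ℝ) ^ (2 * m) ≤ (n : ℝ) ^ (2 * m) * ((1 - x) ^ m * Real.exp (c * (1 + c))) :=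
        le_mul_of_one_le_right (by positivity) h2
    _ = Real.exp (c * (1 + c)) * ((n : ℝ) ^ (2 * m) * (1 - x) ^ m) := by ring
    _ ≤ _ := by gcongr

noncomputable def Cn (c : ℝ) (n : ℕ) : ℝ := Real.exp 3 * (n * c + 1) * Real.exp (c * (1 + c))

lemma main_bound (c : ℝ) (hc : 0 < c) (n : ℕ) (hn : 2 * (1 + c) ≤ n) (m : ℕ)
    (hm : m = ⌊(n : ℝ) * c / 2⌋₊) (w : ℕ → ℝ) (hw : ∀ k, 0 ≤ w k)
    (Z : ℝ) (hZ : HasSum (fun k => poissonPMF c k * w k) Z) :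
    ∑ z : {z : SimpleGraph (Fin n) // Nat.card z.edgeSet = m}, ∏ i, w (gdeg z.1 i) ≤
      Cn c n * Z ^ n * Nat.card {z : SimpleGraph (Fin n) // Nat.card z.edgeSet = m} := by
  have hn0 : (0 : ℝ) < n := by linarith
  have hm1 : 2 * (m : ℝ) ≤ n * c := by
    have := Nat.floor_le (a := (n : ℝ) * c / 2) (by positivity)
    rw [← hm] at this; linarith
  have hm2 : (n : ℝ) * c ≤ 2 * m + 2 := by
    have := Nat.lt_floor_add_one ((n : ℝ) * c / 2)
    rw [← hm] at this; linarith
  have hZ0 : 0 ≤ Z := hZ.nonneg fun k => mul_nonneg (by unfold poissonPMF; positivity) (hw k)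
  have h1 := (graph_sum_le n m w hw).trans (seq_bound n w hw c hc Z hZ)
  have h2 : Fintype.card (Fin m × Bool) = 2 * m := by simp [mul_comm]
  rw [h2] at h1
  have h3 := fact_exp_bound (2 * m) (n * c) (by push_cast; exact hm1) (by push_cast; exact hm2)
  have h4 := graphs_lower n m c hc hn hm1
  have hB : (0 : ℝ) < 2 ^ m * m.factorial := by positivity
  refine le_of_mul_le_mul_left ?_ hB
  refine h1.trans ?_
  rw [mul_pow, ← Real.exp_nat_mul]
  calc ((2 * m).factorial : ℝ) / c ^ (2 * m) * (Real.exp (n * c) * Z ^ n)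
      = ((2 * m).factorial * Real.exp (n * c)) / c ^ (2 * m) * Z ^ n := by ring
    _ ≤ (Real.exp 3 * (n * c + 1) * (n * c) ^ (2 * m)) / c ^ (2 * m) * Z ^ n := by gcongr
    _ = Real.exp 3 * (n * c + 1) * Z ^ n * (n : ℝ) ^ (2 * m) := by rw [mul_pow]; field_simp
    _ ≤ Real.exp 3 * (n * c + 1) * Z ^ n * (Real.exp (c * (1 + c)) * ((2 : ℝ) ^ m * m.factorial *
      Nat.card {z : SimpleGraph (Fin n) // Nat.card z.edgeSet = m})) := by gcongr
    _ = _ := by unfold Cn; ring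

lemma chernoff (c : ℝ) (hc : 0 < c) (n : ℕ) (hn : 2 * (1 + c) ≤ n) (m : ℕ)
    (hm : m = ⌊(n : ℝ) * c / 2⌋₊) (f : ℕ → ℝ)
    (Z : ℝ) (hZ : HasSum (fun k => poissonPMF c k * Real.exp (f k)) Z) (a : ℝ)
    (A : Set (SimpleGraph (Fin n)))
    (hA : ∀ z ∈ A, Nat.card z.edgeSet = m → n * a ≤ ∑ i, f (gdeg z i)) :
    erProb n m A ≤ ENNReal.ofReal (Cn c n * Real.exp (-(n * (a - Z + 1)))) := by
  have h1 := main_bound c hc n hn m hm (fun k => Real.exp (f k)) (fun k => (Real.exp_pos _).le) Z hZ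
  have hC : 0 ≤ Cn c n := by unfold Cn; positivity
  have hZ0 : 0 ≤ Z := hZ.nonneg fun k => mul_nonneg (by unfold poissonPMF; positivity) (Real.exp_pos _).le
  set G : ℕ := Nat.card {z : SimpleGraph (Fin n) // Nat.card z.edgeSet = m} with hG
  have h2 : (Nat.card {z : SimpleGraph (Fin n) // Nat.card z.edgeSet = m ∧ z ∈ A} : ℝ) *
      Real.exp (n * a) ≤ ∑ z : {z : SimpleGraph (Fin n) // Nat.card z.edgeSet = m},
        ∏ i, Real.exp (f (gdeg z.1 i)) := by
    let Ψ : {z : SimpleGraph (Fin n) // Nat.card z.edgeSet = m ∧ z ∈ A} →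
      {z : SimpleGraph (Fin n) // Nat.card z.edgeSet = m} := fun z => ⟨z.1, z.2.1⟩
    have hΨ : Function.Injective Ψ := by
      intro x y h
      simp only [Ψ, Subtype.mk.injEq] at h
      exact Subtype.ext h
    calc _ = ∑ z : {z : SimpleGraph (Fin n) // Nat.card z.edgeSet = m ∧ z ∈ A}, Real.exp (n * a) := by
          rw [Finset.sum_const, nsmul_eq_mul, Finset.card_univ, Nat.card_eq_fintype_card]
      _ ≤ ∑ z : {z : SimpleGraph (Fin n) // Nat.card z.edgeSet = m ∧ z ∈ A},
            ∏ i, Real.exp (f (gdeg (Ψ z).1 i)) := by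
          refine Finset.sum_le_sum fun z _ => ?_
          rw [← Real.exp_sum]
          exact Real.exp_le_exp.2 (hA z.1 z.2.2 z.2.1)
      _ = ∑ z ∈ Finset.univ.map ⟨Ψ, hΨ⟩, ∏ i, Real.exp (f (gdeg z.1 i)) := by
          rw [Finset.sum_map]; rfl
      _ ≤ _ := Finset.sum_le_univ_sum_of_nonneg fun t => Finset.prod_nonneg fun i _ =>
          (Real.exp_pos _).le
  have h3 : Z ^ n ≤ Real.exp (n * (Z - 1)) := by
    rw [Real.exp_nat_mul]
    refine pow_le_pow_left₀ hZ0 ?_ n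
    have := Real.add_one_le_exp (Z - 1); linarith
  have h4 : (Nat.card {z : SimpleGraph (Fin n) // Nat.card z.edgeSet = m ∧ z ∈ A} : ℝ) ≤
      Cn c n * Real.exp (-(n * (a - Z + 1))) * G := by
    have h5 : Real.exp (-(n * (a - Z + 1))) = Real.exp (n * (Z - 1)) * Real.exp (- (n * a)) := by
      rw [← Real.exp_add]; ring_nf
    rw [h5, Real.exp_neg]
    have := h2.trans h1
    rw [← le_div_iff₀ (Real.exp_pos _)] at this
    refine this.trans ?_
    rw [div_eq_mul_inv]
    calc Cn c n * Z ^ n * G * (Real.exp (n * a))⁻¹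
        ≤ Cn c n * Real.exp (n * (Z - 1)) * G * (Real.exp (n * a))⁻¹ := by gcongr
      _ = _ := by ring
  unfold erProb
  refine ENNReal.div_le_of_le_mul ?_
  rw [← hG, ← ENNReal.ofReal_natCast G, ← ENNReal.ofReal_mul (by positivity),
    ← ENNReal.ofReal_natCast]
  exact ENNReal.ofReal_le_ofReal h4

lemma poisson_pos (c : ℝ) (hc : 0 < c) (k : ℕ) : 0 < poissonPMF c k := by
  unfold poissonPMF; positivity

lemma poisson_hasSum (c : ℝ) : HasSum (poissonPMF c) 1 := by
  have h := (NormedSpace.expSeries_div_hasSum_exp (c : ℝ)).mul_left (Real.exp (-c))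
  rw [← Real.exp_eq_exp_ℝ, ← Real.exp_add] at h
  simp only [neg_add_cancel, Real.exp_zero] at h
  have h5 : poissonPMF c = fun k => Real.exp (-c) * (c ^ k / (k.factorial : ℝ)) := by
    funext k; unfold poissonPMF; ring
  rw [h5]; exact h

lemma poisson_exp_summable (c l : ℝ) :
    Summable (fun k : ℕ => poissonPMF c k * Real.exp (l * k)) := by
  have h := (Real.summable_pow_div_factorial (c * Real.exp l)).mul_left (Real.exp (-c))
  refine h.congr fun k => ?_
  unfold poissonPMF
  rw [mul_pow, ← Real.exp_nat_mul, mul_comm (k : ℝ) l]; ring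

lemma hasSum_modify (g h : ℕ → ℝ) (G : ℝ) (hg : HasSum g G) (S : Finset ℕ) :
    HasSum (fun k => if k ∈ S then h k else g k) (G + ∑ k ∈ S, (h k - g k)) := by
  have h1 : HasSum (fun k => if k ∈ S then h k - g k else 0) (∑ k ∈ S, (h k - g k)) := by
    have := hasSum_sum_of_ne_finset_zero (f := fun k => if k ∈ S then h k - g k else 0) (s := S)
      (L := SummationFilter.unconditional ℕ) (fun b hb => if_neg hb)
    rwa [Finset.sum_congr rfl (fun k hk => if_pos hk)] at this
  have h2 := hg.add h1
  have h3 : (fun k => if k ∈ S then h k else g k) =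
      fun k => g k + (if k ∈ S then h k - g k else 0) := by
    funext k; split_ifs <;> ring
  rw [h3]; exact h2

lemma dd_sum {n : ℕ} (hn : 0 < n) (z : SimpleGraph (Fin n)) (f : ℕ → ℝ) (S : Finset ℕ) :
    n * ∑ k ∈ S, f k * degreeDist z k = ∑ i, if gdeg z i ∈ S then f (gdeg z i) else 0 := by
  have hn' : (n : ℝ) ≠ 0 := by positivity
  have h1 : ∀ k, degreeDist z k = (∑ i : Fin n, if gdeg z i = k then (1 : ℝ) else 0) / n := by
    intro k
    unfold degreeDist
    rw [Finset.sum_boole, Nat.card_eq_fintype_card, Fintype.card_subtype]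
    rfl
  simp only [h1, Finset.mul_sum]
  calc _ = ∑ k ∈ S, ∑ i : Fin n, (if gdeg z i = k then f k else 0) := by
        refine Finset.sum_congr rfl fun k _ => ?_
        rw [← mul_assoc, mul_comm (n : ℝ) (f k), mul_assoc, mul_div_cancel₀ _ hn', Finset.mul_sum]
        refine Finset.sum_congr rfl fun i _ => ?_
        split_ifs <;> simp
    _ = _ := by
        rw [Finset.sum_comm]
        refine Finset.sum_congr rfl fun i _ => ?_
        rw [Finset.sum_ite_eq]

lemma gdeg_sum {n : ℕ} (z : SimpleGraph (Fin n)) :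
    ∑ i, (gdeg z i : ℝ) = 2 * (Nat.card z.edgeSet : ℝ) := by
  have h := SimpleGraph.sum_degrees_eq_twice_card_edges z
  have h1 : ∀ i, gdeg z i = z.degree i := by
    intro i
    unfold gdeg
    rw [← SimpleGraph.card_neighborSet_eq_degree, ← Nat.card_eq_fintype_card]
    rfl
  have h2 : Nat.card z.edgeSet = z.edgeFinset.card := by
    rw [Nat.card_eq_fintype_card, SimpleGraph.edgeFinset_card]
  rw [h2]
  simp only [h1]
  exact_mod_cast h

lemma dd_nonneg {n : ℕ} (z : SimpleGraph (Fin n)) (k : ℕ) : 0 ≤ degreeDist z k := by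
  unfold degreeDist; positivity

lemma dd_le_one {n : ℕ} (z : SimpleGraph (Fin n)) (k : ℕ) : degreeDist z k ≤ 1 := by
  unfold degreeDist
  refine div_le_one_of_le₀ ?_ (Nat.cast_nonneg n)
  have : Nat.card {i : Fin n // Nat.card {j : Fin n // z.Adj i j} = k} ≤ Nat.card (Fin n) :=
    Nat.card_le_card_of_injective Subtype.val Subtype.val_injective
  rw [Nat.card_fin] at this
  exact_mod_cast this

lemma erProb_mono (n m : ℕ) {A B : Set (SimpleGraph (Fin n))}
    (h : ∀ z, Nat.card z.edgeSet = m → z ∈ A → z ∈ B) : erProb n m A ≤ erProb n m B := by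
  unfold erProb
  gcongr
  exact Nat.card_le_card_of_injective
    (fun z : {z : SimpleGraph (Fin n) // Nat.card z.edgeSet = m ∧ z ∈ A} =>
      (⟨z.1, z.2.1, h z.1 z.2.1 z.2.2⟩ : {z : SimpleGraph (Fin n) // Nat.card z.edgeSet = m ∧ z ∈ B}))
    (fun x y hxy => Subtype.ext (congrArg (fun w => w.1) hxy))

lemma erProb_empty (n m : ℕ) {A : Set (SimpleGraph (Fin n))}
    (h : ∀ z, Nat.card z.edgeSet = m → z ∉ A) : erProb n m A = 0 := by
  unfold erProb
  have : IsEmpty {z : SimpleGraph (Fin n) // Nat.card z.edgeSet = m ∧ z ∈ A} :=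
    ⟨fun z => h z.1 z.2.1 z.2.2⟩
  rw [Nat.card_of_isEmpty]
  simp

lemma erProb_union (n m : ℕ) (A B : Set (SimpleGraph (Fin n))) :
    erProb n m (A ∪ B) ≤ erProb n m A + erProb n m B := by
  unfold erProb
  rw [← ENNReal.add_div]
  gcongr
  have h := Set.ncard_union_le {z : SimpleGraph (Fin n) | Nat.card z.edgeSet = m ∧ z ∈ A}
    {z : SimpleGraph (Fin n) | Nat.card z.edgeSet = m ∧ z ∈ B}
  have h2 : {z : SimpleGraph (Fin n) | Nat.card z.edgeSet = m ∧ z ∈ A} ∪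
    {z : SimpleGraph (Fin n) | Nat.card z.edgeSet = m ∧ z ∈ B} =
    {z : SimpleGraph (Fin n) | Nat.card z.edgeSet = m ∧ z ∈ A ∪ B} := by
    ext z; simp only [Set.mem_union, Set.mem_ofPred_eq]; tauto
  rw [h2] at h
  exact_mod_cast h

lemma hasSum_of_lub (g : ℕ → ℝ) (hg : ∀ k, 0 ≤ g k) (c : ℝ)
    (h1 : ¬ ∃ K, c < ∑ k ∈ Finset.range K, g k)
    (h2 : ¬ ∃ c' < c, ∀ K, ∑ k ∈ Finset.range K, g k ≤ c') : HasSum g c := by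
  push Not at h1 h2
  rw [hasSum_iff_tendsto_nat_of_nonneg hg]
  refine tendsto_atTop_isLUB ?_ ⟨?_, ?_⟩
  · intro a b hab
    exact Finset.sum_le_sum_of_subset_of_nonneg (Finset.range_mono hab) fun i _ _ => hg i
  · rintro _ ⟨K, rfl⟩; exact h1 K
  · intro b hb
    by_contra hlt
    obtain ⟨K, hK⟩ := h2 b (not_le.1 hlt)
    exact absurd (hb ⟨K, rfl⟩) (not_le.2 hK)

/-- local estimate -/
def LocB (c r : ℝ) (U : Set (ℕ → ℝ)) : Prop :=
  ∀ᶠ n : ℕ in atTop, erProb n ⌊(n : ℝ) * c / 2⌋₊ {z | degreeDist z ∈ U} ≤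
    ENNReal.ofReal (Cn c n * Real.exp (-(n * r)))

lemma locB_empty (c r : ℝ) (hc : 0 < c) (U : Set (ℕ → ℝ))
    (h : ∀ n : ℕ, 0 < n → ∀ z : SimpleGraph (Fin n),
      ∑ i, (gdeg z i : ℝ) ≤ n * c → degreeDist z ∉ U) : LocB c r U := by
  filter_upwards [eventually_gt_atTop 0] with n hn
  rw [erProb_empty]
  · exact zero_le
  · intro z hz
    refine h n hn z ?_
    rw [gdeg_sum, hz]
    have := Nat.floor_le (a := (n : ℝ) * c / 2) (by positivity)
    linarith

lemma locB_chernoff (c r : ℝ) (hc : 0 < c) (U : Set (ℕ → ℝ)) (f : ℕ → ℝ) (Z a : ℝ)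
    (hZ : HasSum (fun k => poissonPMF c k * Real.exp (f k)) Z) (hr : r ≤ a - Z + 1)
    (h : ∀ᶠ n : ℕ in atTop, ∀ z : SimpleGraph (Fin n),
      n * c - 2 ≤ ∑ i, (gdeg z i : ℝ) → degreeDist z ∈ U → n * a ≤ ∑ i, f (gdeg z i)) :
    LocB c r U := by
  filter_upwards [h, tendsto_natCast_atTop_atTop.eventually_ge_atTop (2 * (1 + c))] with n h hn
  refine (chernoff c hc n hn _ rfl f Z hZ a _ ?_).trans (ENNReal.ofReal_le_ofReal ?_)
  · intro z hz hm
    refine h z ?_ hz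
    rw [gdeg_sum, hm]
    have := Nat.lt_floor_add_one ((n : ℝ) * c / 2)
    linarith
  · have hC : 0 ≤ Cn c n := by unfold Cn; positivity
    gcongr

lemma isOpen_lt_sum (S : Finset ℕ) (f : ℕ → ℝ) (a : ℝ) :
    IsOpen {p : ℕ → ℝ | a < ∑ k ∈ S, f k * p k} :=
  isOpen_lt continuous_const (by fun_prop)

lemma isOpen_sum_lt (S : Finset ℕ) (f : ℕ → ℝ) (a : ℝ) :
    IsOpen {p : ℕ → ℝ | ∑ k ∈ S, f k * p k < a} :=
  isOpen_lt (by fun_prop) continuous_const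

lemma local_mean (c r : ℝ) (hc : 0 < c) (p : ℕ → ℝ) (c' : ℝ) (hc' : c' < c)
    (hp : ∀ K, ∑ k ∈ Finset.range K, (k : ℝ) * p k ≤ c') :
    ∃ U, IsOpen U ∧ p ∈ U ∧ LocB c r U := by
  obtain ⟨η, hη, hη4⟩ : ∃ η : ℝ, 0 < η ∧ 4 * η = c - c' := ⟨(c - c') / 4, by linarith, by ring⟩
  set l : ℝ := (|r| + 1) / η with hl
  have hl0 : 0 < l := by positivity
  have hlη : l * η = |r| + 1 := by rw [hl]; field_simp
  obtain ⟨G, hG⟩ := poisson_exp_summable c l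
  have hT := hG.tendsto_sum_nat
  obtain ⟨K, hK⟩ := (hT.eventually (lt_mem_nhds (show G - 1 < G by linarith))).exists
  refine ⟨_, isOpen_sum_lt (Finset.range K) (fun k => (k : ℝ)) (c' + η), ?_, ?_⟩
  · have := hp K
    simp only [Set.mem_ofPred_eq]; linarith
  have hZ := hasSum_modify _ (poissonPMF c) G hG (Finset.range K)
  refine locB_chernoff c r hc _ (fun k => if k ∈ Finset.range K then 0 else l * k)
    (a := l * η) (Z := G + ∑ k ∈ Finset.range K, (poissonPMF c k - poissonPMF c k * Real.exp (l * k)))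
    ?_ ?_ ?_
  · have h1 : (fun k => poissonPMF c k * Real.exp (if k ∈ Finset.range K then 0 else l * k)) =
        fun k => if k ∈ Finset.range K then poissonPMF c k
          else poissonPMF c k * Real.exp (l * k) := by
      funext k
      split_ifs <;> simp
    rw [h1]; exact hZ
  · rw [hlη, Finset.sum_sub_distrib]
    have h1 := sum_le_hasSum (Finset.range K) (fun k _ => (poisson_pos c hc k).le) (poisson_hasSum c)
    have := le_abs_self r
    linarith
  · filter_upwards [tendsto_natCast_atTop_atTop.eventually_ge_atTop (1 / η), eventually_gt_atTop 0]
      with n hn hn0 z hz hU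
    change ∑ k ∈ Finset.range K, (k : ℝ) * degreeDist z k < c' + η at hU
    have h1 := dd_sum hn0 z (fun k => (k : ℝ)) (Finset.range K)
    have h2 : ∑ i, (if gdeg z i ∈ Finset.range K then (0 : ℝ) else l * (gdeg z i : ℝ)) =
        l * (∑ i, (gdeg z i : ℝ) - ∑ i, if gdeg z i ∈ Finset.range K then (gdeg z i : ℝ) else 0) := by
      rw [← Finset.sum_sub_distrib, Finset.mul_sum]
      refine Finset.sum_congr rfl fun i _ => ?_
      split_ifs <;> ring
    rw [h2, ← h1]
    have hn' : (0 : ℝ) < n := by exact_mod_cast hn0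
    have h3 : (n : ℝ) * ∑ k ∈ Finset.range K, (k : ℝ) * degreeDist z k ≤ n * (c' + η) := by
      gcongr
    have h4 : 1 ≤ n * η := by
      rwa [div_le_iff₀ hη] at hn
    calc (n : ℝ) * (l * η) = l * (n * η) := by ring
      _ ≤ _ := by
        refine mul_le_mul_of_nonneg_left ?_ hl0.le
        have : (n : ℝ) * c = n * c' + 4 * (n * η) := by
          have : c = c' + 4 * η := by linarith
          rw [this]; ring
        nlinarith

lemma local_entropy (c r : ℝ) (hc : 0 < c) (p : ℕ → ℝ) (hp : ∀ k, 0 ≤ p k)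
    (hr : (r : EReal) < (relEntropy p (poissonPMF c) : EReal)) :
    ∃ U, IsOpen U ∧ p ∈ U ∧ LocB c r U := by
  set q := poissonPMF c with hq
  have hq0 : ∀ k, 0 < q k := poisson_pos c hc
  set T : ℕ → ℝ := fun k => p k * Real.log (p k / q k) - p k + q k with hT
  have hT0 : ∀ k, 0 ≤ T k := by
    intro k
    rcases (hp k).eq_or_lt with h | h
    · simp only [hT, ← h]; simp [(hq0 k).le]
    · have h1 := Real.log_le_sub_one_of_pos (div_pos (hq0 k) h)
      have h2 : Real.log (p k / q k) = - Real.log (q k / p k) := by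
        rw [← Real.log_inv, inv_div]
      simp only [hT, h2]
      have h3 : p k * Real.log (q k / p k) ≤ p k * (q k / p k - 1) := by gcongr
      have h4 : p k * (q k / p k - 1) = q k - p k := by field_simp
      linarith
  obtain ⟨S, hS⟩ : ∃ S : Finset ℕ, r < ∑ k ∈ S, T k := by
    by_cases hr0 : r < 0
    · exact ⟨∅, by simpa using hr0⟩
    · push Not at hr0
      unfold relEntropy at hr
      rw [if_pos (fun x hx => absurd hx (hq0 x).ne'), ENNReal.tsum_eq_iSup_sum] at hr
      have h1 : (r : EReal) = ((ENNReal.ofReal r : ℝ≥0∞) : EReal) := by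
        rw [EReal.coe_ennreal_ofReal, max_eq_left hr0]
      rw [h1, EReal.coe_ennreal_lt_coe_ennreal_iff, lt_iSup_iff] at hr
      obtain ⟨S, hS⟩ := hr
      rw [← ENNReal.ofReal_sum_of_nonneg (fun k _ => hT0 k)] at hS
      exact ⟨S, (ENNReal.ofReal_lt_ofReal_iff_of_nonneg hr0).1 hS⟩
  have hlim : Tendsto (fun e : ℝ => ∑ k ∈ S, (p k * Real.log ((p k + e) / q k) - (p k + e) + q k))
      (nhdsWithin 0 (Set.Ioi 0)) (nhds (∑ k ∈ S, T k)) := by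
    refine tendsto_nhdsWithin_of_tendsto_nhds (tendsto_finsetSum S fun k _ => ?_)
    have hcont : ContinuousAt
        (fun e : ℝ => p k * Real.log ((p k + e) / q k) - (p k + e) + q k) 0 := by
      rcases (hp k).eq_or_lt with h | h
      · simp only [← h, zero_mul]; fun_prop
      · have : (p k + 0) / q k ≠ 0 := by
          rw [add_zero]; exact (div_pos h (hq0 k)).ne'
        have h2 : ContinuousAt (fun e : ℝ => Real.log ((p k + e) / q k)) 0 :=
          ContinuousAt.log (by fun_prop) this
        fun_prop
    have := hcont.tendsto
    simpa only [add_zero] using this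
  obtain ⟨e, he, he0⟩ := ((hlim.eventually (lt_mem_nhds hS)).and self_mem_nhdsWithin).exists
  have he0 : 0 < e := he0
  set f : ℕ → ℝ := fun k => Real.log ((p k + e) / q k) with hf
  set Z : ℝ := 1 + ∑ k ∈ S, ((p k + e) - q k) with hZdef
  have hZ := hasSum_modify q (fun k => p k + e) 1 (poisson_hasSum c) S
  refine ⟨_, isOpen_lt_sum S f (r + Z - 1), ?_, ?_⟩
  · simp only [Set.mem_ofPred_eq]
    have : ∑ k ∈ S, (p k * Real.log ((p k + e) / q k) - (p k + e) + q k) =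
        ∑ k ∈ S, f k * p k - ∑ k ∈ S, ((p k + e) - q k) := by
      rw [← Finset.sum_sub_distrib]
      refine Finset.sum_congr rfl fun k _ => ?_
      simp only [hf]; ring
    linarith
  · refine locB_chernoff c r hc _ (fun k => if k ∈ S then f k else 0) Z (r + Z - 1) ?_
      (by linarith) ?_
    · have h1 : (fun k => poissonPMF c k * Real.exp (if k ∈ S then f k else 0)) =
          fun k => if k ∈ S then p k + e else q k := by
        funext k
        split_ifs
        · have h2 : 0 < (p k + e) / q k := div_pos (by linarith [hp k]) (hq0 k)
          simp only [hf]
          rw [Real.exp_log h2, ← hq, mul_div_cancel₀ _ (hq0 k).ne']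
        · simp [hq]
      rw [h1]; exact hZ
    · filter_upwards [eventually_gt_atTop 0] with n hn0 z _ hU
      change r + Z - 1 < ∑ k ∈ S, f k * degreeDist z k at hU
      rw [← dd_sum hn0 z f S]
      gcongr

lemma local_all (c r : ℝ) (hc : 0 < c) (p : ℕ → ℝ) (hr : (r : EReal) < (rateI c p : EReal)) :
    ∃ U, IsOpen U ∧ p ∈ U ∧ LocB c r U := by
  by_cases hp : ∃ k, p k < 0
  · obtain ⟨k, hk⟩ := hp
    refine ⟨{p' | p' k < 0}, isOpen_lt (continuous_apply k) continuous_const, hk, ?_⟩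
    refine locB_empty c r hc _ fun n hn z _ h => ?_
    exact absurd (dd_nonneg z k) (not_le.2 h)
  have hp0 : ∀ k, 0 ≤ p k := by push Not at hp; exact hp
  by_cases hm1 : ∃ c' < c, ∀ K, ∑ k ∈ Finset.range K, (k : ℝ) * p k ≤ c'
  · obtain ⟨c', h1, h2⟩ := hm1
    exact local_mean c r hc p c' h1 h2
  by_cases hm2 : ∃ K, c < ∑ k ∈ Finset.range K, (k : ℝ) * p k
  · obtain ⟨K, hK⟩ := hm2
    refine ⟨_, isOpen_lt_sum (Finset.range K) (fun k => (k : ℝ)) c, hK, ?_⟩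
    refine locB_empty c r hc _ fun n hn z hz h => ?_
    simp only [Set.mem_ofPred_eq] at h
    have hn' : (0 : ℝ) < n := by exact_mod_cast hn
    have h1 := mul_lt_mul_of_pos_left h hn'
    rw [dd_sum hn z (fun k => (k : ℝ))] at h1
    have h2 : (∑ i, if gdeg z i ∈ Finset.range K then (gdeg z i : ℝ) else 0) ≤ ∑ i, (gdeg z i : ℝ) := by
      refine Finset.sum_le_sum fun i _ => ?_
      split_ifs
      · exact le_rfl
      · positivity
    linarith
  have hmean := hasSum_of_lub _ (fun k => mul_nonneg (Nat.cast_nonneg k) (hp0 k)) c hm2 hm1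
  by_cases hs2 : ∃ K, 1 < ∑ k ∈ Finset.range K, p k
  · obtain ⟨K, hK⟩ := hs2
    refine ⟨_, isOpen_lt_sum (Finset.range K) (fun k => 1) 1, by simpa using hK, ?_⟩
    refine locB_empty c r hc _ fun n hn z hz h => ?_
    simp only [Set.mem_ofPred_eq] at h
    have hn' : (0 : ℝ) < n := by exact_mod_cast hn
    have h1 := mul_lt_mul_of_pos_left h hn'
    rw [dd_sum hn z (fun k => 1)] at h1
    have h2 : (∑ i, if gdeg z i ∈ Finset.range K then (1 : ℝ) else 0) ≤ ∑ i : Fin n, (1 : ℝ) := by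
      refine Finset.sum_le_sum fun i _ => ?_
      split_ifs <;> norm_num
    simp only [Finset.sum_const, Finset.card_univ, Fintype.card_fin, nsmul_eq_mul] at h2
    linarith
  by_cases hs1 : ∃ s < 1, ∀ K, ∑ k ∈ Finset.range K, p k ≤ s
  · obtain ⟨s, hs, hK⟩ := hs1
    obtain ⟨d, hd, hd2⟩ : ∃ d : ℝ, 0 < d ∧ 2 * d = 1 - s := ⟨(1 - s) / 2, by linarith, by ring⟩
    obtain ⟨K, hKc⟩ := exists_nat_gt (c / d)
    rw [div_lt_iff₀ hd] at hKc
    refine ⟨_, isOpen_sum_lt (Finset.range K) (fun k => 1) (s + d), ?_, ?_⟩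
    · have := hK K
      simp only [Set.mem_ofPred_eq, one_mul]; linarith
    refine locB_empty c r hc _ fun n hn z hz h => ?_
    simp only [Set.mem_ofPred_eq] at h
    have hn' : (0 : ℝ) < n := by exact_mod_cast hn
    have h1 := mul_lt_mul_of_pos_left h hn'
    rw [dd_sum hn z (fun k => 1)] at h1
    have h2 : K * (∑ i : Fin n, (1 : ℝ) - ∑ i, if gdeg z i ∈ Finset.range K then (1 : ℝ) else 0)
        ≤ ∑ i, (gdeg z i : ℝ) := by
      rw [← Finset.sum_sub_distrib, Finset.mul_sum]
      refine Finset.sum_le_sum fun i _ => ?_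
      split_ifs with h
      · simp
      · simp only [Finset.mem_range, not_lt] at h
        simpa using h
    simp only [Finset.sum_const, Finset.card_univ, Fintype.card_fin, nsmul_eq_mul, mul_one] at h2
    have h3 : (K : ℝ) * (n * d) ≤
        K * (n - ∑ i, if gdeg z i ∈ Finset.range K then (1 : ℝ) else 0) := by
      refine mul_le_mul_of_nonneg_left ?_ (Nat.cast_nonneg K)
      have : (n : ℝ) * (s + d) + n * d = n := by
        have : s + d + d = 1 := by linarith
        rw [← mul_add, this, mul_one]
      linarith
    have h4 : (n : ℝ) * c < n * (K * d) := mul_lt_mul_of_pos_left hKc hn'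
    nlinarith
  have hsum := hasSum_of_lub _ hp0 1 hs2 hs1
  unfold rateI at hr
  rw [if_pos ⟨⟨hp0, hsum⟩, hmean⟩] at hr
  exact local_entropy c r hc p hp0 hr

lemma global_bound (c r : ℝ) (hc : 0 < c) (Γ : Set (ℕ → ℝ)) (hΓ : IsClosed Γ)
    (hr : ∀ p ∈ Γ, (r : EReal) < (rateI c p : EReal)) :
    ∃ T : ℝ, 0 ≤ T ∧ ∀ᶠ n : ℕ in atTop,
      erProb n ⌊(n : ℝ) * c / 2⌋₊ {z | degreeDist z ∈ Γ} ≤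
        ENNReal.ofReal (T * (Cn c n * Real.exp (-(n * r)))) := by
  have hcube : IsCompact (Set.univ.pi (fun _ : ℕ => Set.Icc (0 : ℝ) 1)) :=
    isCompact_univ_pi fun _ => isCompact_Icc
  have hQ := hcube.inter_left hΓ
  have hCn : ∀ n, 0 ≤ Cn c n := fun n => by unfold Cn; positivity
  have key : ∃ T : ℝ, 0 ≤ T ∧ ∀ᶠ n : ℕ in atTop,
      erProb n ⌊(n : ℝ) * c / 2⌋₊
        {z | degreeDist z ∈ Γ ∩ (Set.univ.pi (fun _ : ℕ => Set.Icc (0 : ℝ) 1))} ≤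
        ENNReal.ofReal (T * (Cn c n * Real.exp (-(n * r)))) := by
    refine hQ.induction_on (p := fun s => ∃ T : ℝ, 0 ≤ T ∧ ∀ᶠ n : ℕ in atTop,
      erProb n ⌊(n : ℝ) * c / 2⌋₊ {z | degreeDist z ∈ s} ≤
        ENNReal.ofReal (T * (Cn c n * Real.exp (-(n * r))))) ?_ ?_ ?_ ?_
    · refine ⟨0, le_rfl, Eventually.of_forall fun n => ?_⟩
      rw [erProb_empty]
      · exact zero_le
      · simp
    · rintro s t hst ⟨T, hT, h⟩
      refine ⟨T, hT, h.mono fun n hn => (erProb_mono _ _ fun z _ hz => ?_).trans hn⟩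
      exact hst hz
    · rintro s t ⟨T, hT, h⟩ ⟨T', hT', h'⟩
      refine ⟨T + T', by positivity, ?_⟩
      filter_upwards [h, h'] with n h h'
      have hC := hCn n
      rw [add_mul, ENNReal.ofReal_add (by positivity) (by positivity)]
      refine (erProb_union n _ {z | degreeDist z ∈ s} {z | degreeDist z ∈ t}).trans ?_
      gcongr
    · intro p hp
      obtain ⟨U, hU, hpU, hb⟩ := local_all c r hc p (hr p hp.1)
      refine ⟨U, mem_nhdsWithin_of_mem_nhds (hU.mem_nhds hpU), 1, zero_le_one, ?_⟩
      simp only [one_mul]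
      exact hb
  obtain ⟨T, hT, h⟩ := key
  refine ⟨T, hT, h.mono fun n hn => (erProb_mono _ _ fun z _ hz => ?_).trans hn⟩
  exact ⟨hz, fun k _ => ⟨dd_nonneg z k, dd_le_one z k⟩⟩

lemma limsup_bound (c r : ℝ) (hc : 0 < c) (Γ : Set (ℕ → ℝ)) (hΓ : IsClosed Γ)
    (hr : ∀ p ∈ Γ, (r : EReal) < (rateI c p : EReal)) :
    limsup (fun n : ℕ => ((n : ℝ)⁻¹ : EReal) *
        ENNReal.log (erProb n ⌊(n : ℝ) * c / 2⌋₊ {z | degreeDist z ∈ Γ})) atTop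
      ≤ ((-r : ℝ) : EReal) := by
  obtain ⟨T, hT, h⟩ := global_bound c r hc Γ hΓ hr
  set A : ℝ := (T + 1) * Real.exp 3 * Real.exp (c * (1 + c)) with hA
  have hA0 : 0 < A := by positivity
  have hlim : Tendsto (fun n : ℕ => Real.log (A * (n * c + 1)) / n - r) atTop (nhds (-r)) := by
    have h1 : Tendsto (fun n : ℕ => A * ((n : ℝ) * c + 1)) atTop atTop := by
      refine Tendsto.const_mul_atTop hA0 ?_
      exact tendsto_atTop_add_const_right _ _
        (Tendsto.atTop_mul_const hc tendsto_natCast_atTop_atTop)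
    have h2 := Real.isLittleO_log_id_atTop.comp_tendsto h1
    have h3 : (id ∘ fun n : ℕ => A * ((n : ℝ) * c + 1)) =O[atTop] (fun n : ℕ => (n : ℝ)) := by
      refine Asymptotics.IsBigO.of_bound (A * (c + 1)) ?_
      filter_upwards [eventually_ge_atTop 1] with n hn
      have hn' : (1 : ℝ) ≤ n := by exact_mod_cast hn
      simp only [Function.comp, id]
      rw [Real.norm_of_nonneg (by positivity), Real.norm_of_nonneg (by positivity), mul_assoc A]
      refine mul_le_mul_of_nonneg_left ?_ hA0.le
      nlinarith
    have h4 := (h2.trans_isBigO h3).tendsto_div_nhds_zero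
    have h5 := h4.sub_const r
    simpa using h5
  have hlim' : Tendsto (fun n : ℕ => ((Real.log (A * (n * c + 1)) / n - r : ℝ) : EReal)) atTop
      (nhds ((-r : ℝ) : EReal)) := (continuous_coe_real_ereal.tendsto _).comp hlim
  rw [← hlim'.limsup_eq]
  refine limsup_le_limsup ?_
  filter_upwards [h, eventually_gt_atTop 0] with n hn hn0
  have hn' : (0 : ℝ) < n := by exact_mod_cast hn0
  have hpos : 0 < A * (n * c + 1) * Real.exp (-(n * r)) := by positivity
  have h1 : erProb n ⌊(n : ℝ) * c / 2⌋₊ {z | degreeDist z ∈ Γ} ≤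
      ENNReal.ofReal (A * (n * c + 1) * Real.exp (-(n * r))) := by
    refine hn.trans (ENNReal.ofReal_le_ofReal ?_)
    have : A * (n * c + 1) * Real.exp (-(n * r)) = (T + 1) * (Cn c n * Real.exp (-(n * r))) := by
      rw [hA]; unfold Cn; ring
    rw [this]
    have hC : 0 ≤ Cn c n := by unfold Cn; positivity
    gcongr
    linarith
  have h2 := ENNReal.log_le_log h1
  rw [ENNReal.log_ofReal_of_pos hpos, Real.log_mul (by positivity) (by positivity),
    Real.log_exp] at h2
  have h3 : (0 : EReal) ≤ ((n : ℝ)⁻¹ : EReal) := by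
    rw [← EReal.coe_inv]
    exact EReal.coe_nonneg.2 (by positivity)
  refine (mul_le_mul_of_nonneg_left h2 h3).trans (le_of_eq ?_)
  rw [← EReal.coe_inv, ← EReal.coe_mul]
  congr 1
  field_simp
  ring

/-- **Large deviation upper bound** for the degree distribution of the classical
Erdős–Rényi graph `G(n, ⌊nc/2⌋)` with a fixed number of edges: for every weakly
(= pointwise, as `ℕ` is countable and discrete) closed set `Γ` of measures on `ℕ`,
`limsup (1/n) log G(n,⌊nc/2⌋){D_z ∈ Γ} ≤ -inf_{p ∈ Γ} I_c(p)`. -/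
theorem er_ldp_upper_bound (c : ℝ) (hc : 0 < c)
    (Γ : Set (ℕ → ℝ)) (hΓ : IsClosed Γ) :
    limsup (fun n : ℕ => ((n : ℝ)⁻¹ : EReal) *
        ENNReal.log (erProb n ⌊(n : ℝ) * c / 2⌋₊ {z | degreeDist z ∈ Γ})) atTop
      ≤ -(⨅ p ∈ Γ, (rateI c p : EReal)) := by
  rw [← EReal.le_of_forall_lt_iff_le]
  intro x hx
  have h := limsup_bound c (-x) hc Γ hΓ ?_
  · simpa using h
  · intro p hp
    have h1 : ((-x : ℝ) : EReal) < ⨅ p ∈ Γ, (rateI c p : EReal) := by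
      rw [EReal.coe_neg]
      exact EReal.neg_lt_comm.1 hx
    exact h1.trans_le (iInf₂_le p hp)
end
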